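/- With A_{2,±}(v) = Ai(ξ₂+η₂²+v)·exp(±(ξ₂+v)η₂ ± 2η₂³/3) and K₂* = 𝐀_{2,−}𝐀_{2,+} on L²(ℝ₊), the quantity a₀(ξ₂,η₂) = tr (I−K₂*)^{-1} A_{2,−}⊗A_{2,+} equals F₂'(ξ₂+η₂²)/F₂(ξ₂+η₂²), where F₂ is the GUE Tracy–Widom distribution. -/

import Mathlib

open MeasureTheory Complex

/-- The Airy function, defined via the contour integral over the vertical line through 1. -/
noncomputable def Ai (x : ℝ) : ℝ :=
  ((2 * (Real.pi : ℂ) * Complex.I)⁻¹ *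
    ∫ t : ℝ, Complex.exp ((1 + (t : ℂ) * Complex.I) ^ 3 / 3
      - (x : ℂ) * (1 + (t : ℂ) * Complex.I)) * Complex.I).re

/-- `A_{+}(v) = Ai(ξ+η²+v)·exp((ξ+v)η + 2η³/3)`. -/
noncomputable def Apl (ξ η v : ℝ) : ℝ :=
  Ai (ξ + η ^ 2 + v) * Real.exp ((ξ + v) * η + 2 * η ^ 3 / 3)

/-- `A_{−}(v) = Ai(ξ+η²+v)·exp(−(ξ+v)η − 2η³/3)`. -/
noncomputable def Ami (ξ η v : ℝ) : ℝ :=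
  Ai (ξ + η ^ 2 + v) * Real.exp (-((ξ + v) * η) - 2 * η ^ 3 / 3)

/-- The kernel of `K₂* = 𝐀₋𝐀₊` on `L²(ℝ₊)`. -/
noncomputable def Kstar (ξ η : ℝ) (v₁ v₂ : ℝ) : ℝ :=
  ∫ l in Set.Ioi (0 : ℝ), Ami ξ η (v₁ + l) * Apl ξ η (l + v₂)

/-- Composition of integral kernels on `L²(ℝ₊)`. -/
noncomputable def kComp (K L : ℝ → ℝ → ℝ) (v₁ v₂ : ℝ) : ℝ :=
  ∫ l in Set.Ioi (0 : ℝ), K v₁ l * L l v₂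

/-- The Fredholm determinant `det(I + K)` of an integral kernel on `L²(ℝ₊)`. -/
noncomputable def fredholmDet1 (K : ℝ → ℝ → ℝ) : ℝ :=
  ∑' n : ℕ, (1 / (Nat.factorial n) : ℝ) *
    ∫ x in {x : Fin n → ℝ | ∀ i, 0 < x i}, Matrix.det (Matrix.of fun i j => K (x i) (x j))

/-- The shifted Airy kernel. -/
noncomputable def KAi (ξ : ℝ) (v₁ v₂ : ℝ) : ℝ :=
  ∫ s in Set.Ioi (0 : ℝ), Ai (ξ + v₁ + s) * Ai (ξ + v₂ + s)

/-- The GUE Tracy–Widom distribution `F₂(ξ) = det(I − K_{Ai,ξ})`. -/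
noncomputable def F₂ (ξ : ℝ) : ℝ := fredholmDet1 (fun v₁ v₂ => -(KAi ξ v₁ v₂))

open Filter Topology

/-- The entire functions `∫ wⁿ exp(w³/3 - z w) dt` over the vertical line `w = 1 + i t`. -/
noncomputable def airyMoment (n : ℕ) (z : ℂ) : ℂ :=
  ∫ t : ℝ, (1 + (t : ℂ) * I) ^ n * Complex.exp ((1 + (t : ℂ) * I) ^ 3 / 3 - z * (1 + (t : ℂ) * I))

lemma norm_airyIntegrand_le (n : ℕ) (z : ℂ) (t : ℝ) :
    ‖(1 + (t : ℂ) * I) ^ n * Complex.exp ((1 + (t : ℂ) * I) ^ 3 / 3 - z * (1 + (t : ℂ) * I))‖ ≤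
      n.factorial * Real.exp (4 / 3 - z.re + (|z.im| + 1) ^ 2 / 2) *
        Real.exp (-(1 / 2) * t ^ 2) := by
  have h1 : ‖(1 + (t : ℂ) * I) ^ n‖ ≤ n.factorial * Real.exp (1 + |t|) := by
    rw [norm_pow]
    have hw : ‖1 + (t : ℂ) * I‖ ≤ 1 + |t| := (norm_add_le _ _).trans (by simp)
    have h2 := Real.pow_div_factorial_le_exp (1 + |t|) (by positivity) n
    rw [div_le_iff₀ (by positivity)] at h2
    calc ‖1 + (t : ℂ) * I‖ ^ n ≤ (1 + |t|) ^ n := by gcongr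
      _ ≤ _ := by linarith
  have h2 : ((1 + (t : ℂ) * I) ^ 3 / 3 - z * (1 + (t : ℂ) * I)).re
      = 1 / 3 - t ^ 2 - z.re + t * z.im := by
    have : (1 + (t : ℂ) * I) ^ 3 / 3 =
        ((1 / 3 - t ^ 2 : ℝ) : ℂ) + ((t - t ^ 3 / 3 : ℝ) : ℂ) * I := by
      push_cast
      have := I_sq
      linear_combination (t ^ 2 + t ^ 3 * I / 3 : ℂ) * this
    rw [this, sub_re, add_re, ofReal_re, re_ofReal_mul, I_re, mul_re]
    simp
    ring
  rw [norm_mul, Complex.norm_exp, h2]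
  calc _ ≤ n.factorial * Real.exp (1 + |t|) * Real.exp (1 / 3 - t ^ 2 - z.re + t * z.im) := by
        gcongr
    _ = n.factorial * Real.exp (1 + |t| + (1 / 3 - t ^ 2 - z.re + t * z.im)) := by
        rw [mul_assoc, ← Real.exp_add]
    _ ≤ n.factorial * Real.exp (4 / 3 - z.re + (|z.im| + 1) ^ 2 / 2 + (-(1 / 2) * t ^ 2)) := by
        refine mul_le_mul_of_nonneg_left (Real.exp_le_exp.2 ?_) (by positivity)
        have h3 : t * z.im ≤ |t| * |z.im| := by rw [← abs_mul]; exact le_abs_self _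
        nlinarith [sq_nonneg (|t| - (|z.im| + 1)), sq_abs t]
    _ = _ := by rw [mul_assoc, ← Real.exp_add]

lemma continuous_airyIntegrand (n : ℕ) (z : ℂ) : Continuous fun t : ℝ =>
    (1 + (t : ℂ) * I) ^ n * Complex.exp ((1 + (t : ℂ) * I) ^ 3 / 3 - z * (1 + (t : ℂ) * I)) := by
  fun_prop

lemma integrable_gaussian_half : Integrable fun t : ℝ => Real.exp (-(1 / 2) * t ^ 2) :=
  integrable_exp_neg_mul_sq (by norm_num)

lemma integrable_airyIntegrand (n : ℕ) (z : ℂ) : Integrable fun t : ℝ =>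
    (1 + (t : ℂ) * I) ^ n * Complex.exp ((1 + (t : ℂ) * I) ^ 3 / 3 - z * (1 + (t : ℂ) * I)) :=
  (integrable_gaussian_half.const_mul _).mono' (continuous_airyIntegrand n z).aestronglyMeasurable
    (Eventually.of_forall fun t => norm_airyIntegrand_le n z t)

lemma norm_airyMoment_le (n : ℕ) : ∃ C, 0 ≤ C ∧ ∀ z : ℂ,
    ‖airyMoment n z‖ ≤ C * Real.exp (-z.re + (|z.im| + 1) ^ 2 / 2) := by
  refine ⟨n.factorial * Real.exp (4 / 3) * ∫ t : ℝ, Real.exp (-(1 / 2) * t ^ 2),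
    mul_nonneg (by positivity) (integral_nonneg fun _ => (Real.exp_pos _).le), fun z => ?_⟩
  calc ‖airyMoment n z‖ ≤ ∫ t : ℝ, n.factorial * Real.exp (4 / 3 - z.re + (|z.im| + 1) ^ 2 / 2) *
        Real.exp (-(1 / 2) * t ^ 2) :=
        norm_integral_le_of_norm_le (integrable_gaussian_half.const_mul _)
          (Eventually.of_forall fun t => norm_airyIntegrand_le n z t)
    _ = _ := by
        rw [integral_const_mul, show 4 / 3 - z.re + (|z.im| + 1) ^ 2 / 2 =
          4 / 3 + (- z.re + (|z.im| + 1) ^ 2 / 2) by ring, Real.exp_add]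
        ring

lemma hasDerivAt_airyMoment (n : ℕ) (z : ℂ) :
    HasDerivAt (airyMoment n) (-airyMoment (n + 1) z) z := by
  have h := (hasDerivAt_integral_of_dominated_loc_of_deriv_le (μ := volume) (𝕜 := ℂ)
    (F := fun (z : ℂ) (t : ℝ) => (1 + (t : ℂ) * I) ^ n *
      Complex.exp ((1 + (t : ℂ) * I) ^ 3 / 3 - z * (1 + (t : ℂ) * I)))
    (F' := fun (z : ℂ) (t : ℝ) => -((1 + (t : ℂ) * I) ^ (n + 1) *
      Complex.exp ((1 + (t : ℂ) * I) ^ 3 / 3 - z * (1 + (t : ℂ) * I))))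
    (x₀ := z) (s := Metric.ball z 1)
    (bound := fun t => (n + 1).factorial *
      Real.exp (4 / 3 - z.re + 1 + (|z.im| + 1 + 1) ^ 2 / 2) * Real.exp (-(1 / 2) * t ^ 2))
    (Metric.ball_mem_nhds _ one_pos)
    (Eventually.of_forall fun z => (continuous_airyIntegrand n z).aestronglyMeasurable)
    (integrable_airyIntegrand n z)
    (continuous_airyIntegrand (n + 1) z).neg.aestronglyMeasurable
    (Eventually.of_forall fun t w hw => ?_)
    (integrable_gaussian_half.const_mul _)
    (Eventually.of_forall fun t w hw => ?_)).2
  · rw [integral_neg] at h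
    exact h
  · rw [norm_neg]
    refine (norm_airyIntegrand_le (n + 1) w t).trans ?_
    rw [mem_ball_iff_norm] at hw
    have h1 : |w.re - z.re| ≤ 1 := by
      rw [← sub_re]; exact (abs_re_le_norm _).trans hw.le
    have h2 : |w.im| ≤ |z.im| + 1 := by
      have h3 : |w.im - z.im| ≤ 1 := by rw [← sub_im]; exact (abs_im_le_norm _).trans hw.le
      have := abs_sub_abs_le_abs_sub w.im z.im
      linarith
    have := (abs_le.1 h1).1
    gcongr
    linarith
  · have h1 : HasDerivAt (fun z : ℂ => (1 + (t : ℂ) * I) ^ 3 / 3 - z * (1 + (t : ℂ) * I))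
        (-(1 * (1 + (t : ℂ) * I))) w :=
      ((hasDerivAt_id w).mul_const _).const_sub _
    convert! (h1.cexp.const_mul ((1 + (t : ℂ) * I) ^ n)) using 1
    ring

lemma airyMoment_two (z : ℂ) : airyMoment 2 z = z * airyMoment 0 z := by
  set F : ℝ → ℂ := fun t => Complex.exp ((1 + (t : ℂ) * I) ^ 3 / 3 - z * (1 + (t : ℂ) * I)) with hF
  have hd : ∀ t : ℝ, HasDerivAt F
      (((1 + (t : ℂ) * I) ^ 2 * F t - z * ((1 + (t : ℂ) * I) ^ 0 * F t)) * I) t := by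
    intro t
    have h0 : HasDerivAt (fun t : ℝ => 1 + (t : ℂ) * I) I t := by
      simpa using ((hasDerivAt_id t).ofReal_comp.mul_const I).const_add (1 : ℂ)
    have h1 := (((h0.pow 3).div_const 3).sub (h0.const_mul z)).cexp
    convert! h1 using 1
    simp [hF]
    ring
  have hi2 := integrable_airyIntegrand 2 z
  have hi0 := integrable_airyIntegrand 0 z
  have hlim : Tendsto F (cocompact ℝ) (𝓝 0) := by
    have hg : Tendsto (fun t : ℝ => ((0 : ℕ).factorial *
        Real.exp (4 / 3 - z.re + (|z.im| + 1) ^ 2 / 2)) * Real.exp (-(1 / 2) * t ^ 2))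
        (cocompact ℝ) (𝓝 0) := by
      have := tendsto_rpow_abs_mul_exp_neg_mul_sq_cocompact (a := 1 / 2) (by norm_num) 0
      simpa using this.const_mul ((0 : ℕ).factorial *
        Real.exp (4 / 3 - z.re + (|z.im| + 1) ^ 2 / 2))
    refine squeeze_zero_norm (fun t => ?_) hg
    simpa [hF] using norm_airyIntegrand_le 0 z t
  have := integral_of_hasDerivAt_of_tendsto hd ((hi2.sub (hi0.const_mul z)).mul_const I)
    (hlim.mono_left atBot_le_cocompact) (hlim.mono_left atTop_le_cocompact)
  rw [integral_mul_const, integral_sub hi2 (hi0.const_mul z), integral_const_mul, sub_zero] at this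
  have h2 := (mul_eq_zero.1 this).resolve_right I_ne_zero
  exact sub_eq_zero.1 h2

/-- The derivative of the Airy function. -/
noncomputable def dAi (x : ℝ) : ℝ := -((2 * Real.pi)⁻¹ * (airyMoment 1 x).re)

lemma Ai_eq (x : ℝ) : Ai x = (2 * Real.pi)⁻¹ * (airyMoment 0 x).re := by
  have : (2 * (Real.pi : ℂ) * I)⁻¹ * (airyMoment 0 x * I)
      = ((2 * Real.pi)⁻¹ : ℝ) * airyMoment 0 x := by
    have hpi : (Real.pi : ℂ) ≠ 0 := by exact_mod_cast Real.pi_ne_zero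
    push_cast
    field_simp [I_ne_zero]
  rw [Ai, integral_mul_const]
  simp only [airyMoment, pow_zero, one_mul] at this ⊢
  rw [this, re_ofReal_mul]

lemma hasDerivAt_re_airyMoment (n : ℕ) (x : ℝ) :
    HasDerivAt (fun x : ℝ => (airyMoment n x).re) (-(airyMoment (n + 1) x).re) x := by
  simpa using (hasDerivAt_airyMoment n (x : ℂ)).real_of_complex

lemma hasDerivAt_Ai (x : ℝ) : HasDerivAt Ai (dAi x) x := by
  rw [funext Ai_eq]
  convert! (hasDerivAt_re_airyMoment 0 x).const_mul (2 * Real.pi)⁻¹ using 1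
  rw [dAi]; ring_nf

lemma hasDerivAt_dAi (x : ℝ) : HasDerivAt dAi (x * Ai x) x := by
  convert! ((hasDerivAt_re_airyMoment 1 x).const_mul (2 * Real.pi)⁻¹).neg using 1
  rw [airyMoment_two, re_ofReal_mul, Ai_eq]
  ring

lemma continuous_Ai : Continuous Ai :=
  continuous_iff_continuousAt.2 fun x => (hasDerivAt_Ai x).continuousAt

lemma abs_re_airyMoment_le (n : ℕ) : ∃ C, 0 ≤ C ∧ ∀ x : ℝ,
    |(2 * Real.pi)⁻¹ * (airyMoment n x).re| ≤ C * Real.exp (-x) := by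
  obtain ⟨C, hC, h⟩ := norm_airyMoment_le n
  refine ⟨(2 * Real.pi)⁻¹ * (C * Real.exp (1 / 2)), by positivity, fun x => ?_⟩
  have h1 := (abs_re_le_norm _).trans (h x)
  rw [abs_mul, abs_of_nonneg (by positivity), mul_assoc, mul_assoc, ← Real.exp_add]
  simp at h1 ⊢
  gcongr
  rwa [add_comm]

lemma abs_Ai_le : ∃ C, 0 ≤ C ∧ ∀ x : ℝ, |Ai x| ≤ C * Real.exp (-x) := by
  simp_rw [Ai_eq]; exact abs_re_airyMoment_le 0

lemma abs_dAi_le : ∃ C, 0 ≤ C ∧ ∀ x : ℝ, |dAi x| ≤ C * Real.exp (-x) := by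
  simp_rw [dAi, abs_neg]; exact abs_re_airyMoment_le 1

lemma differentiable_airyMoment (n : ℕ) : Differentiable ℂ (airyMoment n) :=
  fun z => (hasDerivAt_airyMoment n z).differentiableAt

/-- The real part of an entire function is real analytic along the real line. -/
lemma analyticOnNhd_re_ofReal {f : ℂ → ℂ} (hf : Differentiable ℂ f) :
    AnalyticOnNhd ℝ (fun x : ℝ => (f x).re) Set.univ := by
  intro x _
  have h1 : AnalyticAt ℝ f (x : ℂ) := (hf.analyticAt x).restrictScalars
  exact (Complex.reCLM.analyticAt _).comp (h1.comp (Complex.ofRealCLM.analyticAt x))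

lemma analyticOnNhd_Ai : AnalyticOnNhd ℝ Ai Set.univ := by
  rw [funext Ai_eq]
  exact analyticOnNhd_const.mul (analyticOnNhd_re_ofReal (differentiable_airyMoment 0))

/-- Lebesgue measure on the half line. -/
noncomputable abbrev halfLine : Measure ℝ := volume.restrict (Set.Ioi 0)

lemma integrable_exp_neg_two : Integrable (fun s : ℝ => Real.exp (-2 * s)) halfLine :=
  integrableOn_exp_mul_Ioi (by norm_num) 0

lemma integral_exp_neg_two : ∫ s : ℝ, Real.exp (-2 * s) ∂halfLine = 1 / 2 := by
  have := integral_exp_mul_Ioi (a := -2) (by norm_num) 0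
  rw [this]; norm_num

lemma abs_mul_Ai_le : ∃ C, 0 ≤ C ∧ ∀ x y s : ℝ,
    |Ai (x + s) * Ai (y + s)| ≤ C * Real.exp (-x - y) * Real.exp (-2 * s) := by
  obtain ⟨C, hC, h⟩ := abs_Ai_le
  refine ⟨C * C, by positivity, fun x y s => ?_⟩
  rw [abs_mul]
  calc _ ≤ (C * Real.exp (-(x + s))) * (C * Real.exp (-(y + s))) := by
        gcongr
        exacts [h _, h _]
    _ = C * C * Real.exp (-(x + s) + -(y + s)) := by rw [Real.exp_add]; ring
    _ = C * C * Real.exp ((-x - y) + -2 * s) := by ring_nf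
    _ = _ := by rw [Real.exp_add]; ring

lemma integrable_mul_Ai (x y : ℝ) :
    Integrable (fun s => Ai (x + s) * Ai (y + s)) halfLine := by
  obtain ⟨C, hC, h⟩ := abs_mul_Ai_le
  have := continuous_Ai
  exact (integrable_exp_neg_two.const_mul _).mono'
    (by fun_prop : Continuous fun s => Ai (x + s) * Ai (y + s)).aestronglyMeasurable
    (Eventually.of_forall fun s => h x y s)

lemma abs_KAi_le : ∃ C, 0 ≤ C ∧ ∀ ξ x y : ℝ,
    |KAi ξ x y| ≤ C * Real.exp (-2 * ξ) * (Real.exp (-x) * Real.exp (-y)) := by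
  obtain ⟨C, hC, h⟩ := abs_mul_Ai_le
  refine ⟨C * (1 / 2), by positivity, fun ξ x y => ?_⟩
  rw [← Real.norm_eq_abs]
  calc ‖KAi ξ x y‖ ≤ ∫ s, C * Real.exp (-(ξ + x) - (ξ + y)) * Real.exp (-2 * s) ∂halfLine :=
        norm_integral_le_of_norm_le (integrable_exp_neg_two.const_mul _)
          (Eventually.of_forall fun s => h (ξ + x) (ξ + y) s)
    _ = C * (1 / 2) * Real.exp (-(ξ + x) - (ξ + y)) := by
        rw [integral_const_mul, integral_exp_neg_two]; ring
    _ = C * (1 / 2) * Real.exp (-2 * ξ + (-x + -y)) := by ring_nf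
    _ = _ := by rw [Real.exp_add, Real.exp_add]; ring

lemma KAi_comm (ξ x y : ℝ) : KAi ξ x y = KAi ξ y x := by
  simp only [KAi, mul_comm]

lemma continuous_KAi (ξ : ℝ) : Continuous fun p : ℝ × ℝ => KAi ξ p.1 p.2 := by
  obtain ⟨C, hC, h⟩ := abs_mul_Ai_le
  have hcont := continuous_Ai
  refine continuous_iff_continuousAt.2 fun p => ?_
  refine continuousAt_of_dominated
    (bound := fun s => C * Real.exp (-(ξ + p.1 - 1) - (ξ + p.2 - 1)) * Real.exp (-2 * s))
    (Eventually.of_forall fun q => (integrable_mul_Ai (ξ + q.1) (ξ + q.2)).aestronglyMeasurable) ?_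
    (integrable_exp_neg_two.const_mul _) (Eventually.of_forall fun s => by fun_prop)
  have h1 : ∀ᶠ q : ℝ × ℝ in 𝓝 p, p.1 - 1 < q.1 :=
    continuous_fst.continuousAt.eventually (lt_mem_nhds (by linarith))
  have h2 : ∀ᶠ q : ℝ × ℝ in 𝓝 p, p.2 - 1 < q.2 :=
    continuous_snd.continuousAt.eventually (lt_mem_nhds (by linarith))
  filter_upwards [h1, h2] with q hq1 hq2
  refine Eventually.of_forall fun s => (h (ξ + q.1) (ξ + q.2) s).trans ?_
  gcongr <;> linarith

lemma hasDerivAt_KAi (ξ x y : ℝ) :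
    HasDerivAt (fun ξ => KAi ξ x y) (-(Ai (ξ + x) * Ai (ξ + y))) ξ := by
  have hcont := continuous_Ai
  set f : ℝ → ℝ := fun u => Ai (x + u) * Ai (y + u) with hf
  have hfc : Continuous f := by fun_prop
  have hshift : ∀ c : ℝ, KAi c x y = ∫ u in Set.Ioi c, f u := by
    intro c
    have := (measurePreserving_add_left volume c).setIntegral_preimage_emb
      (MeasurableEquiv.addLeft c).measurableEmbedding f (Set.Ioi c)
    rw [Set.preimage_const_add_Ioi, sub_self] at this
    rw [← this, KAi]
    refine integral_congr_ae (Eventually.of_forall fun s => ?_)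
    simp only [hf]
    ring_nf
  have hInt : ∀ c : ℝ, IntegrableOn f (Set.Ioi c) := by
    intro c
    obtain ⟨C, hC, h⟩ := abs_mul_Ai_le
    exact Integrable.mono' ((integrableOn_exp_mul_Ioi (by norm_num : (-2 : ℝ) < 0) c).const_mul _)
      hfc.aestronglyMeasurable (Eventually.of_forall fun s => h x y s)
  have heq : ∀ c : ℝ, KAi c x y = (∫ u in Set.Ioi ξ, f u) - ∫ u in ξ..c, f u := by
    intro c
    rw [hshift, ← intervalIntegral.integral_Ioi_sub_Ioi' (hInt ξ) (hInt c)]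
    ring
  rw [funext heq]
  have := (intervalIntegral.integral_hasDerivAt_right (hfc.intervalIntegrable ξ ξ)
    (hfc.stronglyMeasurableAtFilter _ _) hfc.continuousAt).const_sub (∫ u in Set.Ioi ξ, f u)
  convert! this using 1
  simp only [hf]
  ring_nf

lemma ae_Ai_ne_zero (hne : ∃ x, Ai x ≠ 0) : ∀ᵐ x : ℝ, Ai x ≠ 0 := by
  obtain ⟨x, hx⟩ := hne
  have h := analyticOnNhd_Ai.preimage_zero_mem_codiscrete hx
  have h2 := ae_restrict_le_codiscreteWithin (μ := (volume : Measure ℝ)) MeasurableSet.univ h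
  rw [Measure.restrict_univ] at h2
  filter_upwards [h2] with y hy
  simpa using hy

lemma KAi_self_ne_zero (hne : ∃ x, Ai x ≠ 0) (ξ l : ℝ) : KAi ξ l l ≠ 0 := by
  intro h
  have h1 := (integral_eq_zero_iff_of_nonneg (fun s => mul_self_nonneg (Ai (ξ + l + s)))
    (integrable_mul_Ai (ξ + l) (ξ + l))).1 h
  have h2 : ∀ᵐ s ∂halfLine, Ai (ξ + l + s) ≠ 0 :=
    ae_restrict_of_ae ((measurePreserving_add_left volume (ξ + l)).quasiMeasurePreserving.ae
      (ae_Ai_ne_zero hne))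
  have h3 : ∀ᵐ s ∂halfLine, False := by
    filter_upwards [h1, h2] with s hs1 hs2
    exact hs2 (mul_self_eq_zero.1 hs1)
  rw [eventually_false_iff_eq_bot, ae_eq_bot, Measure.restrict_eq_zero] at h3
  simp at h3

lemma analyticOnNhd_KAi (ξ l : ℝ) : AnalyticOnNhd ℝ (fun x => KAi ξ x l) Set.univ := by
  obtain ⟨C, hC, h⟩ := abs_Ai_le
  obtain ⟨C0, hC0, h0⟩ := norm_airyMoment_le 0
  obtain ⟨C1, hC1, h1⟩ := norm_airyMoment_le 1
  have hA := continuous_Ai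
  have hM : ∀ n, Continuous (airyMoment n) := fun n => (differentiable_airyMoment n).continuous
  set F : ℂ → ℝ → ℂ := fun z s =>
    airyMoment 0 (ξ + z + s) * (((2 * Real.pi)⁻¹ * Ai (ξ + l + s) : ℝ) : ℂ) with hF
  set F' : ℂ → ℝ → ℂ := fun z s =>
    -airyMoment 1 (ξ + z + s) * (((2 * Real.pi)⁻¹ * Ai (ξ + l + s) : ℝ) : ℂ) with hF'
  have hFc : ∀ z, Continuous (F z) := fun z => by have := hM 0; fun_prop
  have hF'c : ∀ z, Continuous (F' z) := fun z => by have := hM 1; fun_prop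
  have hbd : ∀ (n : ℕ) (D : ℝ), 0 ≤ D → (∀ z : ℂ,
      ‖airyMoment n z‖ ≤ D * Real.exp (-z.re + (|z.im| + 1) ^ 2 / 2)) → ∀ (z : ℂ) (s : ℝ),
      ‖airyMoment n (ξ + z + s) * (((2 * Real.pi)⁻¹ * Ai (ξ + l + s) : ℝ) : ℂ)‖ ≤
      D * C * (2 * Real.pi)⁻¹ * Real.exp (-(ξ + z.re) - (ξ + l) + (|z.im| + 1) ^ 2 / 2)
        * Real.exp (-2 * s) := by
    intro n D hD hDb z s
    rw [norm_mul, Complex.norm_real, norm_mul, Real.norm_of_nonneg (by positivity :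
      0 ≤ (2 * Real.pi)⁻¹), Real.norm_eq_abs]
    have e1 := hDb (ξ + z + s)
    simp only [add_re, add_im, ofReal_re, ofReal_im, zero_add, add_zero] at e1
    calc _ ≤ (D * Real.exp (-(ξ + z.re + s) + (|z.im| + 1) ^ 2 / 2)) *
          ((2 * Real.pi)⁻¹ * (C * Real.exp (-(ξ + l + s)))) := by
          gcongr
          exact h _
      _ = D * C * (2 * Real.pi)⁻¹ * (Real.exp (-(ξ + z.re + s) + (|z.im| + 1) ^ 2 / 2) *
          Real.exp (-(ξ + l + s))) := by ring
      _ = D * C * (2 * Real.pi)⁻¹ * (Real.exp (-(ξ + z.re) - (ξ + l) + (|z.im| + 1) ^ 2 / 2) *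
          Real.exp (-2 * s)) := by
          rw [← Real.exp_add, ← Real.exp_add]; ring_nf
      _ = _ := by ring
  have hFi : ∀ z, Integrable (F z) halfLine := fun z =>
    (integrable_exp_neg_two.const_mul _).mono' (hFc z).aestronglyMeasurable
      (Eventually.of_forall (hbd 0 C0 hC0 h0 z))
  have hdiff : Differentiable ℂ fun z => ∫ s, F z s ∂halfLine := by
    intro z
    refine (hasDerivAt_integral_of_dominated_loc_of_deriv_le (F := F) (F' := F')
      (s := Metric.ball z 1)
      (bound := fun s => C1 * C * (2 * Real.pi)⁻¹ *
        Real.exp (-(ξ + (z.re - 1)) - (ξ + l) + ((|z.im| + 1) + 1) ^ 2 / 2) * Real.exp (-2 * s))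
      (Metric.ball_mem_nhds _ one_pos)
      (Eventually.of_forall fun z => (hFc z).aestronglyMeasurable) (hFi z)
      (hF'c z).aestronglyMeasurable
      (Eventually.of_forall fun s w hw => ?_)
      (integrable_exp_neg_two.const_mul _)
      (Eventually.of_forall fun s w hw => ?_)).2.differentiableAt
    · simp only [hF']
      rw [neg_mul, norm_neg]
      refine (hbd 1 C1 hC1 h1 w s).trans ?_
      rw [mem_ball_iff_norm] at hw
      have g1 : |w.re - z.re| ≤ 1 := by
        rw [← sub_re]; exact (abs_re_le_norm _).trans hw.le
      have g2 : |w.im| ≤ |z.im| + 1 := by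
        have h3 : |w.im - z.im| ≤ 1 := by rw [← sub_im]; exact (abs_im_le_norm _).trans hw.le
        have := abs_sub_abs_le_abs_sub w.im z.im
        linarith
      have g3 := (abs_le.1 g1).1
      gcongr
      linarith
    · have e : HasDerivAt (fun z : ℂ => (ξ : ℂ) + z + s) 1 w :=
        ((hasDerivAt_id w).const_add _).add_const _
      have := ((hasDerivAt_airyMoment 0 (ξ + w + s)).comp w e).mul_const
        (((2 * Real.pi)⁻¹ * Ai (ξ + l + s) : ℝ) : ℂ)
      convert! this using 1
      simp [hF']
  convert! analyticOnNhd_re_ofReal hdiff using 2 with x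
  have := Complex.reCLM.integral_comp_comm (hFi x)
  simp only [reCLM_apply] at this
  rw [← this, KAi]
  refine integral_congr_ae (Eventually.of_forall fun s => ?_)
  simp only [hF, re_mul_ofReal, Ai_eq (ξ + x + s)]
  push_cast
  ring

/-- The zero set of a section of the Airy kernel is null. -/
lemma volume_KAi_eq_zero (hne : ∃ x, Ai x ≠ 0) (ξ l : ℝ) :
    ∀ᵐ x : ℝ, KAi ξ x l ≠ 0 := by
  have h := (analyticOnNhd_KAi ξ l).preimage_zero_mem_codiscrete (KAi_self_ne_zero hne ξ l)
  have h2 := ae_restrict_le_codiscreteWithin (μ := (volume : Measure ℝ)) MeasurableSet.univ h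
  rw [Measure.restrict_univ] at h2
  filter_upwards [h2] with y hy
  simpa using hy

lemma hasDerivAt_Ai_mul_dAi (x : ℝ) :
    HasDerivAt (fun x => Ai x * dAi x) (dAi x ^ 2 + x * Ai x ^ 2) x := by
  convert! (hasDerivAt_Ai x).mul (hasDerivAt_dAi x) using 1
  ring

lemma continuous_dAi : Continuous dAi :=
  continuous_iff_continuousAt.2 fun x => (hasDerivAt_dAi x).continuousAt

lemma tendsto_of_abs_le_exp_neg {f : ℝ → ℝ} (hf : ∃ C, 0 ≤ C ∧ ∀ x : ℝ, |f x| ≤ C * Real.exp (-x)) :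
    Tendsto f atTop (𝓝 0) := by
  obtain ⟨C, _, h⟩ := hf
  refine squeeze_zero_norm h ?_
  simpa using (Real.tendsto_exp_neg_atTop_nhds_zero.const_mul C)

lemma monotoneOn_Ai_mul_dAi : MonotoneOn (fun x => Ai x * dAi x) (Set.Ici 0) := by
  refine monotoneOn_of_deriv_nonneg (convex_Ici 0)
    (continuous_Ai.mul continuous_dAi).continuousOn
    (fun x _ => (hasDerivAt_Ai_mul_dAi x).differentiableAt.differentiableWithinAt) fun x hx => ?_
  rw [interior_Ici] at hx
  rw [(hasDerivAt_Ai_mul_dAi x).deriv]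
  have : (0 : ℝ) < x := hx
  positivity

lemma Ai_mul_dAi_nonpos {x : ℝ} (hx : 0 ≤ x) : Ai x * dAi x ≤ 0 := by
  have hlim : Tendsto (fun x => Ai x * dAi x) atTop (𝓝 0) := by
    simpa using (tendsto_of_abs_le_exp_neg abs_Ai_le).mul (tendsto_of_abs_le_exp_neg abs_dAi_le)
  refine ge_of_tendsto hlim ?_
  filter_upwards [eventually_ge_atTop x] with y hy
  exact monotoneOn_Ai_mul_dAi hx (hx.trans hy : 0 ≤ y) hy

lemma Ai_ne_zero_of_pos (hne : ∃ x, Ai x ≠ 0) {x : ℝ} (hx : 0 < x) : Ai x ≠ 0 := by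
  intro h0
  have hz : ∀ y, x ≤ y → Ai y * dAi y = 0 := fun y hy =>
    le_antisymm (Ai_mul_dAi_nonpos (hx.le.trans hy)) (by
      have := monotoneOn_Ai_mul_dAi (Set.mem_Ici.2 hx.le) (Set.mem_Ici.2 (hx.le.trans hy)) hy
      simpa [h0] using this)
  have hAi : ∀ y, x < y → Ai y = 0 := by
    intro y hy
    have h1 : (fun y => Ai y * dAi y) =ᶠ[𝓝 y] fun _ => 0 := by
      filter_upwards [lt_mem_nhds hy] with z hzz using hz z hzz.le
    have h2 := (hasDerivAt_Ai_mul_dAi y).unique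
      ((hasDerivAt_const y (0 : ℝ)).congr_of_eventuallyEq h1)
    have h3 : 0 < y := hx.trans hy
    have h4 : y * Ai y ^ 2 = 0 := le_antisymm (by nlinarith [sq_nonneg (dAi y)]) (by positivity)
    simpa [h3.ne'] using h4
  have h5 := ae_Ai_ne_zero hne
  have h6 : ∀ᵐ y ∂(volume.restrict (Set.Ioi x)), False := by
    filter_upwards [ae_restrict_of_ae h5, ae_restrict_mem measurableSet_Ioi] with y hy1 hy2
    exact hy1 (hAi y hy2)
  rw [eventually_false_iff_eq_bot, ae_eq_bot, Measure.restrict_eq_zero] at h6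
  simp at h6

lemma mul_sq_Ai_le_sq_dAi {l x : ℝ} (hl : 0 ≤ l) (hx : l ≤ x) : l * Ai x ^ 2 ≤ dAi x ^ 2 := by
  have hd : ∀ x, HasDerivAt (fun x => dAi x ^ 2 - l * Ai x ^ 2)
      (2 * (x - l) * (Ai x * dAi x)) x := by
    intro x
    convert! ((hasDerivAt_dAi x).pow 2).sub (((hasDerivAt_Ai x).pow 2).const_mul l) using 1
    push_cast
    ring
  have hanti : AntitoneOn (fun x => dAi x ^ 2 - l * Ai x ^ 2) (Set.Ici l) := by
    refine antitoneOn_of_deriv_nonpos (convex_Ici l)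
      (fun x _ => (hd x).continuousAt.continuousWithinAt)
      (fun x _ => (hd x).differentiableAt.differentiableWithinAt) fun x hx => ?_
    rw [interior_Ici] at hx
    have hx' : l < x := hx
    rw [(hd x).deriv]
    exact mul_nonpos_of_nonneg_of_nonpos (by linarith) (Ai_mul_dAi_nonpos (by linarith))
  have hlim : Tendsto (fun x => dAi x ^ 2 - l * Ai x ^ 2) atTop (𝓝 0) := by
    simpa using ((tendsto_of_abs_le_exp_neg abs_dAi_le).pow 2).sub
      (((tendsto_of_abs_le_exp_neg abs_Ai_le).pow 2).const_mul l)
  have : 0 ≤ dAi x ^ 2 - l * Ai x ^ 2 := by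
    refine le_of_tendsto hlim ?_
    filter_upwards [eventually_ge_atTop x] with y hy
    exact hanti hx (hx.trans hy : l ≤ y) hy
  linarith

lemma exists_sign_Ai (hne : ∃ x, Ai x ≠ 0) :
    ∃ σ : ℝ, |σ| = 1 ∧ ∀ x, 0 < x → σ * Ai x = |Ai x| := by
  rcases (isPreconnected_Ioi (a := (0 : ℝ))).eq_or_eq_neg_of_sq_eq (f := fun x => |Ai x|) (g := Ai)
    continuous_Ai.abs.continuousOn continuous_Ai.continuousOn (fun x _ => sq_abs (Ai x))
    (fun hx => Ai_ne_zero_of_pos hne hx) with h | h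
  · exact ⟨1, by simp, fun x hx => by rw [one_mul]; exact (h hx).symm⟩
  · exact ⟨-1, by simp, fun x hx => by rw [neg_one_mul]; exact (h hx).symm⟩

/-- The tail integral of the modulus of the Airy function. -/
noncomputable def airyTail (l : ℝ) : ℝ := ∫ s, |Ai (l + s)| ∂halfLine

lemma integrable_exp_neg_half : Integrable (fun s : ℝ => Real.exp (-s)) halfLine :=
  integrableOn_exp_neg_Ioi 0

lemma integrable_mul_exp_neg : Integrable (fun s : ℝ => s * Real.exp (-s)) halfLine := by
  have := Real.GammaIntegral_convergent (s := 2) (by norm_num)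
  refine (this.congr_fun (fun s hs => ?_) measurableSet_Ioi)
  norm_num
  ring

lemma integrable_Ai_shift (l : ℝ) : Integrable (fun s => Ai (l + s)) halfLine := by
  obtain ⟨C, hC, h⟩ := abs_Ai_le
  have hA := continuous_Ai
  refine (integrable_exp_neg_half.const_mul (C * Real.exp (-l))).mono'
    (by fun_prop : Continuous fun s => Ai (l + s)).aestronglyMeasurable
    (Eventually.of_forall fun s => (h (l + s)).trans_eq ?_)
  rw [neg_add, Real.exp_add]; ring

lemma integrable_mul_shift {f : ℝ → ℝ} (hf : Continuous f)
    (hb : ∃ C, 0 ≤ C ∧ ∀ x : ℝ, |f x| ≤ C * Real.exp (-x)) (l : ℝ) :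
    Integrable (fun s => s * f (l + s)) halfLine := by
  obtain ⟨C, hC, h⟩ := hb
  refine (integrable_mul_exp_neg.const_mul (C * Real.exp (-l))).mono'
    (by fun_prop : Continuous fun s => s * f (l + s)).aestronglyMeasurable ?_
  filter_upwards [ae_restrict_mem measurableSet_Ioi] with s hs
  have hs' : (0 : ℝ) < s := hs
  rw [norm_mul, Real.norm_of_nonneg hs'.le, Real.norm_eq_abs]
  calc s * |f (l + s)| ≤ s * (C * Real.exp (-(l + s))) := by gcongr; exact h _
    _ = _ := by rw [neg_add, Real.exp_add]; ring

lemma airyTail_nonneg (l : ℝ) : 0 ≤ airyTail l := integral_nonneg fun _ => abs_nonneg _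

lemma integral_Ai_eq_neg_integral_mul_dAi (l : ℝ) :
    ∫ s, Ai (l + s) ∂halfLine = -∫ s, s * dAi (l + s) ∂halfLine := by
  have hd : ∀ s ∈ Set.Ici (0 : ℝ), HasDerivAt (fun s => s * Ai (l + s))
      (Ai (l + s) + s * dAi (l + s)) s := by
    intro s _
    convert! (hasDerivAt_id s).mul ((hasDerivAt_Ai (l + s)).comp_const_add l s) using 1
    simp
  have hi := integrable_Ai_shift l
  have hi2 := integrable_mul_shift continuous_dAi abs_dAi_le l
  have hlim : Tendsto (fun s => s * Ai (l + s)) atTop (𝓝 0) := by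
    obtain ⟨C, hC, h⟩ := abs_Ai_le
    have hl := (Real.tendsto_pow_mul_exp_neg_atTop_nhds_zero 1).const_mul (C * Real.exp (-l))
    rw [mul_zero] at hl
    refine squeeze_zero_norm' ?_ hl
    filter_upwards [eventually_ge_atTop 0] with s hs
    rw [norm_mul, Real.norm_of_nonneg hs, Real.norm_eq_abs]
    calc s * |Ai (l + s)| ≤ s * (C * Real.exp (-(l + s))) := by gcongr; exact h _
      _ = _ := by rw [neg_add, Real.exp_add]; ring
  have := integral_Ioi_of_hasDerivAt_of_tendsto' hd (hi.add hi2) hlim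
  rw [integral_add hi hi2] at this
  simp at this
  linarith

lemma sqrt_mul_integral_le_airyTail (hne : ∃ x, Ai x ≠ 0) {l : ℝ} (hl : 0 < l) :
    √l * ∫ s, s * |Ai (l + s)| ∂halfLine ≤ airyTail l := by
  obtain ⟨σ, hσ, hs⟩ := exists_sign_Ai hne
  have hA := continuous_Ai
  have hi2 := integrable_mul_shift continuous_dAi abs_dAi_le l
  have hi3 : Integrable (fun s => s * |Ai (l + s)|) halfLine :=
    integrable_mul_shift (f := fun x => |Ai x|) (by fun_prop)
      (by simpa only [abs_abs] using abs_Ai_le) l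
  have h1 : airyTail l = ∫ s, s * (-σ * dAi (l + s)) ∂halfLine := by
    calc airyTail l = ∫ s, σ * Ai (l + s) ∂halfLine := by
          refine integral_congr_ae ?_
          filter_upwards [ae_restrict_mem measurableSet_Ioi] with s hs0
          exact (hs _ (add_pos hl hs0)).symm
      _ = ∫ s, -σ * (s * dAi (l + s)) ∂halfLine := by
          rw [integral_const_mul, integral_const_mul, integral_Ai_eq_neg_integral_mul_dAi]; ring
      _ = _ := by congr 1; ext s; ring
  rw [h1, ← integral_const_mul]
  refine integral_mono_ae (hi3.const_mul _) ?_ ?_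
  · convert! hi2.const_mul (-σ) using 2; ring
  · filter_upwards [ae_restrict_mem measurableSet_Ioi] with s hs0
    have hs0 : 0 < s := hs0
    have hls : 0 < l + s := by linarith
    have e1 := mul_sq_Ai_le_sq_dAi hl.le (by linarith : l ≤ l + s)
    have e2 := Ai_mul_dAi_nonpos hls.le
    have e3 := hs _ hls
    have hp := abs_pos.2 (Ai_ne_zero_of_pos hne hls)
    have hσ2 : σ * σ = 1 := by rw [← abs_mul_abs_self, hσ, one_mul]
    have e4 : 0 ≤ -σ * dAi (l + s) := by
      by_contra hcon
      push Not at hcon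
      have : (σ * Ai (l + s)) * (-σ * dAi (l + s)) = -(Ai (l + s) * dAi (l + s)) := by
        linear_combination (-(Ai (l + s) * dAi (l + s))) * hσ2
      rw [e3] at this
      nlinarith [mul_pos_of_neg_of_neg hcon (neg_lt_zero.2 hp)]
    have e5 : √l * |Ai (l + s)| ≤ -σ * dAi (l + s) := by
      refine abs_le_of_sq_le_sq' ?_ e4 |>.2
      rw [mul_pow, Real.sq_sqrt hl.le, sq_abs]
      calc _ ≤ dAi (l + s) ^ 2 := e1
        _ = _ := by linear_combination (-(dAi (l + s) ^ 2)) * hσ2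
    show √l * (s * |Ai (l + s)|) ≤ s * (-σ * dAi (l + s))
    nlinarith [mul_le_mul_of_nonneg_left e5 hs0.le]

lemma abs_KAi_le_airyTail (ξ : ℝ) : ∃ C, 0 ≤ C ∧ ∀ x l : ℝ,
    |KAi ξ x l| ≤ C * Real.exp (-x) * airyTail (ξ + l) := by
  obtain ⟨C, hC, h⟩ := abs_Ai_le
  refine ⟨C * Real.exp (-ξ), by positivity, fun x l => ?_⟩
  rw [airyTail, ← integral_const_mul, ← Real.norm_eq_abs]
  refine norm_integral_le_of_norm_le ((integrable_Ai_shift (ξ + l)).abs.const_mul _) ?_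
  filter_upwards [ae_restrict_mem measurableSet_Ioi] with s hs
  rw [norm_mul, Real.norm_eq_abs, Real.norm_eq_abs]
  gcongr
  refine (h _).trans ?_
  rw [mul_assoc, ← Real.exp_add]
  have : (0 : ℝ) < s := hs
  gcongr
  linarith

lemma abs_Ai_sub_le : ∃ C, 0 ≤ C ∧ ∀ x s : ℝ, 0 ≤ s →
    |Ai (x + s) - Ai x| ≤ C * Real.exp (-x) * s := by
  obtain ⟨C, hC, h⟩ := abs_dAi_le
  refine ⟨C, hC, fun x s hs => ?_⟩
  have := Convex.norm_image_sub_le_of_norm_hasDerivWithin_le (f := Ai) (f' := dAi)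
    (C := C * Real.exp (-x)) (s := Set.Ici x) (x := x) (y := x + s)
    (fun y _ => (hasDerivAt_Ai y).hasDerivWithinAt)
    (fun y hy => (h y).trans (by have : x ≤ y := hy; gcongr)) (convex_Ici x)
    Set.self_mem_Ici (by simpa using hs)
  simpa [abs_of_nonneg hs] using this

lemma exists_airyTail_le_abs_KAi (hne : ∃ x, Ai x ≠ 0) {ξ x : ℝ} (hx : Ai (ξ + x) ≠ 0) :
    ∃ c L, 0 < c ∧ ∀ l, L ≤ l → c * airyTail (ξ + l) ≤ |KAi ξ x l| := by
  obtain ⟨C, hC, hlip⟩ := abs_Ai_sub_le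
  obtain ⟨σ, hσ, hs⟩ := exists_sign_Ai hne
  have hA := continuous_Ai
  set A := |Ai (ξ + x)| with hAdef
  have hApos : 0 < A := abs_pos.2 hx
  set D := C * Real.exp (-(ξ + x)) with hD
  have hD0 : 0 ≤ D := by positivity
  refine ⟨A / 2, 1 + (2 * D / A) ^ 2 - ξ, by positivity, fun l hl => ?_⟩
  have hm : 0 < ξ + l := by nlinarith [sq_nonneg (2 * D / A)]
  have hsq : 2 * D / A ≤ √(ξ + l) := Real.le_sqrt_of_sq_le (by linarith)
  have hi := integrable_Ai_shift (ξ + l)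
  have hi3 : Integrable (fun s => s * |Ai (ξ + l + s)|) halfLine :=
    integrable_mul_shift (f := fun x => |Ai x|) (by fun_prop)
      (by simpa only [abs_abs] using abs_Ai_le) (ξ + l)
  have htail : airyTail (ξ + l) = |∫ s, Ai (ξ + l + s) ∂halfLine| := by
    have : airyTail (ξ + l) = σ * ∫ s, Ai (ξ + l + s) ∂halfLine := by
      rw [← integral_const_mul]
      refine integral_congr_ae ?_
      filter_upwards [ae_restrict_mem measurableSet_Ioi] with s hs0
      exact (hs _ (add_pos hm hs0)).symm
    rw [← abs_of_nonneg (airyTail_nonneg (ξ + l)), this, abs_mul, hσ, one_mul]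
  have hdiff : |KAi ξ x l - Ai (ξ + x) * ∫ s, Ai (ξ + l + s) ∂halfLine| ≤
      D * ∫ s, s * |Ai (ξ + l + s)| ∂halfLine := by
    rw [KAi, ← integral_const_mul, ← integral_const_mul,
      ← integral_sub (integrable_mul_Ai _ _) (hi.const_mul _), ← Real.norm_eq_abs]
    refine norm_integral_le_of_norm_le (hi3.const_mul _) ?_
    filter_upwards [ae_restrict_mem measurableSet_Ioi] with s hs0
    have hs0 : (0 : ℝ) < s := hs0
    rw [← sub_mul, norm_mul, Real.norm_eq_abs, Real.norm_eq_abs, ← mul_assoc]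
    gcongr
    exact hlip _ _ hs0.le
  have hq := sqrt_mul_integral_le_airyTail hne hm
  set q := ∫ s, s * |Ai (ξ + l + s)| ∂halfLine with hqdef
  have hq0 : 0 ≤ q := by
    refine integral_nonneg_of_ae ?_
    filter_upwards [ae_restrict_mem measurableSet_Ioi] with s hs0
    exact mul_nonneg (le_of_lt hs0) (abs_nonneg _)
  have h1 : A * airyTail (ξ + l) ≤ |KAi ξ x l| + D * q := by
    rw [htail, hAdef, ← abs_mul]
    have := abs_sub_abs_le_abs_sub (Ai (ξ + x) * ∫ s, Ai (ξ + l + s) ∂halfLine) (KAi ξ x l)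
    rw [abs_sub_comm] at this
    linarith
  have h2 : D * q ≤ A / 2 * airyTail (ξ + l) := by
    have : 2 * D / A * q ≤ airyTail (ξ + l) := (by gcongr : _ ≤ √(ξ + l) * q).trans hq
    calc D * q = A / 2 * (2 * D / A * q) := by field_simp
      _ ≤ _ := by gcongr
  linarith

/-- Functions that are measurable on the half line and decay at least like `exp (-x)`. -/
def ExpDecay (f : ℝ → ℝ) : Prop :=
  AEStronglyMeasurable f halfLine ∧ ∃ C, 0 ≤ C ∧ ∀ x : ℝ, |f x| ≤ C * Real.exp (-x)

lemma ExpDecay.integrable_mul {f g : ℝ → ℝ} (hf : ExpDecay f) (hg : ExpDecay g) :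
    Integrable (fun x => f x * g x) halfLine := by
  obtain ⟨hm, C, hC, h⟩ := hf
  obtain ⟨hm', C', hC', h'⟩ := hg
  refine (integrable_exp_neg_two.const_mul (C * C')).mono' (hm.mul hm') (Eventually.of_forall ?_)
  intro x
  rw [norm_mul, Real.norm_eq_abs, Real.norm_eq_abs]
  calc |f x| * |g x| ≤ (C * Real.exp (-x)) * (C' * Real.exp (-x)) := by gcongr <;> grind
    _ = C * C' * (Real.exp (-x) * Real.exp (-x)) := by ring
    _ = _ := by rw [← Real.exp_add]; ring_nf

lemma expDecay_Ai (ξ : ℝ) : ExpDecay fun x => Ai (ξ + x) := by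
  have := continuous_Ai
  obtain ⟨C, hC, h⟩ := abs_Ai_le
  refine ⟨(by fun_prop : Continuous fun x => Ai (ξ + x)).aestronglyMeasurable,
    C * Real.exp (-ξ), by positivity, fun x => (h _).trans_eq ?_⟩
  rw [neg_add, Real.exp_add]; ring

lemma continuous_KAi_left (ξ y : ℝ) : Continuous fun x => KAi ξ x y :=
  ContinuousOn.comp_continuous (f := fun x : ℝ => (x, y)) (continuous_KAi ξ).continuousOn
    (by fun_prop) (s := Set.univ) (by simp)

lemma continuous_KAi_right (ξ x : ℝ) : Continuous fun y => KAi ξ x y :=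
  ContinuousOn.comp_continuous (f := fun y : ℝ => (x, y)) (continuous_KAi ξ).continuousOn
    (by fun_prop) (s := Set.univ) (by simp)

lemma expDecay_KAi_left (ξ y : ℝ) : ExpDecay fun x => KAi ξ x y := by
  obtain ⟨C, hC, h⟩ := abs_KAi_le
  exact ⟨(continuous_KAi_left ξ y).aestronglyMeasurable,
    C * Real.exp (-2 * ξ) * Real.exp (-y), by positivity, fun x => (h ξ x y).trans_eq (by ring)⟩

lemma expDecay_KAi_right (ξ x : ℝ) : ExpDecay fun y => KAi ξ x y := by
  simpa only [KAi_comm ξ x] using expDecay_KAi_left ξ x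

lemma ExpDecay.add {f g : ℝ → ℝ} (hf : ExpDecay f) (hg : ExpDecay g) :
    ExpDecay fun x => f x + g x := by
  obtain ⟨hm, C, hC, h⟩ := hf
  obtain ⟨hm', C', hC', h'⟩ := hg
  refine ⟨hm.add hm', C + C', by positivity, fun x => (abs_add_le _ _).trans ?_⟩
  rw [add_mul]
  exact add_le_add (h x) (h' x)

lemma ExpDecay.const_mul {f : ℝ → ℝ} (hf : ExpDecay f) (c : ℝ) : ExpDecay fun x => c * f x := by
  obtain ⟨hm, C, hC, h⟩ := hf
  refine ⟨hm.const_mul c, |c| * C, by positivity, fun x => ?_⟩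
  rw [abs_mul, mul_assoc]
  gcongr
  exact h x

section Resolvent

variable {ξ y : ℝ} {r : ℝ → ℝ}

lemma frequently_integrable_mul_of_resolvent
    (hr : ∀ v, r v = KAi ξ v y + ∫ l, KAi ξ v l * r l ∂halfLine) :
    ∃ᶠ v in ae halfLine, Integrable (fun l => KAi ξ v l * r l) halfLine := by
  intro hS
  have h1 : r =ᵐ[halfLine] fun v => KAi ξ v y := by
    filter_upwards [hS] with v hv
    rw [hr v, integral_undef hv, add_zero]
  have h2 : ∀ v, Integrable (fun l => KAi ξ v l * r l) halfLine := by
    intro v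
    refine ((expDecay_KAi_right ξ v).integrable_mul (expDecay_KAi_left ξ y)).congr ?_
    filter_upwards [h1] with l hl
    rw [hl]
  have h3 : ∀ᵐ v ∂halfLine, False := by
    filter_upwards [hS] with v hv using hv (h2 v)
  rw [eventually_false_iff_eq_bot, ae_eq_bot, Measure.restrict_eq_zero] at h3
  simp at h3

lemma locallyIntegrable_of_resolvent (hne : ∃ x, Ai x ≠ 0)
    (hr : ∀ v, r v = KAi ξ v y + ∫ l, KAi ξ v l * r l ∂halfLine) :
    LocallyIntegrable r halfLine := by
  intro l₀
  obtain ⟨s, hs, hs0⟩ := ((frequently_integrable_mul_of_resolvent hr).and_eventually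
    (ae_restrict_of_ae (volume_KAi_eq_zero hne ξ l₀))).exists
  have hcont := continuous_KAi_right ξ s
  set c := |KAi ξ s l₀| / 2 with hc
  have hcpos : 0 < c := by have := abs_pos.2 hs0; positivity
  have hU : {l | c < |KAi ξ s l|} ∈ 𝓝 l₀ :=
    (isOpen_lt continuous_const hcont.abs).mem_nhds (by
      have := abs_pos.2 hs0; show c < |KAi ξ s l₀|; linarith)
  have hUm : MeasurableSet {l | c < |KAi ξ s l|} :=
    (isOpen_lt continuous_const hcont.abs).measurableSet
  refine ⟨_, hU, ?_⟩
  have := (hs.mono_measure (Measure.restrict_le_self (s := {l | c < |KAi ξ s l|}))).bdd_mul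
    (f := fun l => (KAi ξ s l)⁻¹) (c := c⁻¹) (hcont.measurable.inv.aestronglyMeasurable) (by
      filter_upwards [ae_restrict_mem hUm] with l hl
      rw [norm_inv, Real.norm_eq_abs]
      have hl : c < |KAi ξ s l| := hl
      gcongr)
  refine this.congr ?_
  filter_upwards [ae_restrict_mem hUm] with l hl
  have hl : c < |KAi ξ s l| := hl
  have : KAi ξ s l ≠ 0 := abs_pos.1 (hcpos.trans hl)
  field_simp

lemma expDecay_of_resolvent (hne : ∃ x, Ai x ≠ 0)
    (hr : ∀ v, r v = KAi ξ v y + ∫ l, KAi ξ v l * r l ∂halfLine) : ExpDecay r := by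
  have hloc := locallyIntegrable_of_resolvent hne hr
  have hm := hloc.aestronglyMeasurable
  have hAi : ∀ᵐ s ∂halfLine, Ai (ξ + s) ≠ 0 :=
    ae_restrict_of_ae ((measurePreserving_add_left volume ξ).quasiMeasurePreserving.ae
      (ae_Ai_ne_zero hne))
  obtain ⟨s, hs, hs0⟩ := ((frequently_integrable_mul_of_resolvent hr).and_eventually hAi).exists
  obtain ⟨c, L, hc, hcL⟩ := exists_airyTail_le_abs_KAi hne hs0
  obtain ⟨C, hC, hT⟩ := abs_KAi_le_airyTail ξ
  obtain ⟨C₂, hC₂, hK⟩ := abs_KAi_le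
  set B : ℝ → ℝ := fun l => C / c * |KAi ξ s l * r l| +
    (Set.Icc 0 L).indicator (fun l => C₂ * Real.exp (-2 * ξ) * |r l|) l with hB
  have hBi : Integrable B halfLine := by
    refine (hs.abs.const_mul _).add ?_
    rw [integrable_indicator_iff measurableSet_Icc]
    exact ((hloc.integrableOn_isCompact isCompact_Icc).abs.const_mul _)
  have hle : ∀ v, ∀ᵐ l ∂halfLine, ‖KAi ξ v l * r l‖ ≤ Real.exp (-v) * B l := by
    intro v
    filter_upwards [ae_restrict_mem measurableSet_Ioi] with l hl
    have hl : 0 < l := hl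
    rw [norm_mul, Real.norm_eq_abs, Real.norm_eq_abs]
    rcases le_or_gt l L with hlL | hlL
    · have hmem : l ∈ Set.Icc 0 L := ⟨hl.le, hlL⟩
      simp only [hB, Set.indicator_of_mem hmem]
      have e1 : Real.exp (-l) ≤ 1 := Real.exp_le_one_iff.2 (by linarith)
      calc |KAi ξ v l| * |r l| ≤ C₂ * Real.exp (-2 * ξ) * (Real.exp (-v) * 1) * |r l| := by
            gcongr
            exact (hK ξ v l).trans (by gcongr)
        _ = Real.exp (-v) * (0 + C₂ * Real.exp (-2 * ξ) * |r l|) := by ring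
        _ ≤ _ := by gcongr; positivity
    · have hmem : l ∉ Set.Icc 0 L := fun h => absurd h.2 (by linarith)
      simp only [hB, Set.indicator_of_notMem hmem, add_zero]
      have e1 : airyTail (ξ + l) ≤ |KAi ξ s l| / c := by
        rw [le_div_iff₀ hc, mul_comm]; exact hcL l hlL.le
      calc |KAi ξ v l| * |r l| ≤ C * Real.exp (-v) * (|KAi ξ s l| / c) * |r l| := by
            gcongr
            exact (hT v l).trans (by gcongr)
        _ = _ := by rw [abs_mul]; ring
  have hB0 : 0 ≤ ∫ l, B l ∂halfLine := by
    refine integral_nonneg fun l => add_nonneg (by positivity) (Set.indicator_nonneg ?_ _)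
    intro _ _; positivity
  refine ⟨hm, C₂ * Real.exp (-2 * ξ) * Real.exp (-y) + ∫ l, B l ∂halfLine, by positivity,
    fun v => ?_⟩
  rw [hr v]
  refine (abs_add_le _ _).trans ?_
  rw [add_mul]
  refine add_le_add ((hK ξ v y).trans_eq (by ring)) ?_
  rw [← Real.norm_eq_abs, mul_comm, ← integral_const_mul]
  exact norm_integral_le_of_norm_le (hBi.const_mul _) (hle v)

end Resolvent

lemma integral_mul_KAi_comm {f g : ℝ → ℝ} (hf : ExpDecay f) (hg : ExpDecay g) (ξ : ℝ) :
    ∫ x, f x * ∫ l, KAi ξ x l * g l ∂halfLine ∂halfLine =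
      ∫ l, g l * ∫ x, KAi ξ l x * f x ∂halfLine ∂halfLine := by
  have hInt : Integrable (fun p : ℝ × ℝ => f p.1 * (KAi ξ p.1 p.2 * g p.2))
      (halfLine.prod halfLine) := by
    obtain ⟨hfm, C, hC, hf⟩ := hf
    obtain ⟨hgm, C', hC', hg⟩ := hg
    obtain ⟨C₂, hC₂, hK⟩ := abs_KAi_le
    refine ((integrable_exp_neg_two.mul_prod integrable_exp_neg_two).const_mul
      (C * (C₂ * Real.exp (-2 * ξ)) * C')).mono' ?_ (Eventually.of_forall fun p => ?_)
    · exact hfm.comp_fst.mul ((continuous_KAi ξ).aestronglyMeasurable.mul hgm.comp_snd)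
    · rw [norm_mul, norm_mul]
      simp only [Real.norm_eq_abs]
      have e : ∀ x : ℝ, Real.exp (-2 * x) = Real.exp (-x) * Real.exp (-x) := fun x => by
        rw [← Real.exp_add]; ring_nf
      calc |f p.1| * (|KAi ξ p.1 p.2| * |g p.2|) ≤ (C * Real.exp (-p.1)) *
            (C₂ * Real.exp (-2 * ξ) * (Real.exp (-p.1) * Real.exp (-p.2)) *
              (C' * Real.exp (-p.2))) := by
            gcongr
            exacts [hf _, hK _ _ _, hg _]
        _ = _ := by rw [e p.1, e p.2]; ring
  simp_rw [← integral_const_mul]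
  rw [integral_integral_swap hInt]
  refine integral_congr_ae (Eventually.of_forall fun l => integral_congr_ae
    (Eventually.of_forall fun x => ?_))
  simp only [KAi_comm ξ x l]
  ring

lemma integral_mul_eq_of_resolvent {ξ : ℝ} {f g f' g' : ℝ → ℝ} (hf : ExpDecay f) (hg : ExpDecay g)
    (hf' : ExpDecay f') (hg' : ExpDecay g')
    (h : ∀ x, f x = g x + ∫ l, KAi ξ x l * f l ∂halfLine)
    (h' : ∀ x, f' x = g' x + ∫ l, KAi ξ x l * f' l ∂halfLine) :
    ∫ x, f' x * g x ∂halfLine = ∫ x, f x * g' x ∂halfLine := by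
  have hswap := integral_mul_KAi_comm hf' hf ξ
  have e1 : ∀ x, ∫ l, KAi ξ x l * f l ∂halfLine = f x - g x := fun x => by rw [h x]; ring
  have e2 : ∀ x, ∫ l, KAi ξ x l * f' l ∂halfLine = f' x - g' x := fun x => by rw [h' x]; ring
  simp only [e1, e2, mul_sub] at hswap
  rw [integral_sub (hf'.integrable_mul hf) (hf'.integrable_mul hg),
    integral_sub (hf.integrable_mul hf') (hf.integrable_mul hg')] at hswap
  simp only [mul_comm (f' _) (f _)] at hswap
  linarith

section Resolvent

variable {ξ : ℝ} {R : ℝ → ℝ → ℝ}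

lemma eq_zero_of_eq_integral_KAi_mul (hne : ∃ x, Ai x ≠ 0)
    (hR : ∀ v w, R v w = KAi ξ v w + ∫ l, KAi ξ v l * R l w ∂halfLine)
    {φ : ℝ → ℝ} (hφ : ExpDecay φ) (h : ∀ x, φ x = ∫ l, KAi ξ x l * φ l ∂halfLine) (y : ℝ) :
    φ y = 0 := by
  have h0 : ExpDecay fun _ => (0 : ℝ) := ⟨aestronglyMeasurable_const, 0, le_rfl, by simp⟩
  have := integral_mul_eq_of_resolvent (ξ := ξ) hφ h0
    (expDecay_of_resolvent hne fun v => hR v y)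
    (expDecay_KAi_left ξ y) (fun x => by rw [zero_add]; exact h x) (fun v => hR v y)
  rw [h y]
  simpa [mul_comm, KAi_comm ξ y] using this.symm

lemma resolvent_comm (hne : ∃ x, Ai x ≠ 0)
    (hR : ∀ v w, R v w = KAi ξ v w + ∫ l, KAi ξ v l * R l w ∂halfLine) (x y : ℝ) :
    R x y = R y x := by
  have := integral_mul_eq_of_resolvent (ξ := ξ)
    (expDecay_of_resolvent hne fun v => hR v x) (expDecay_KAi_left ξ x)
    (expDecay_of_resolvent hne fun v => hR v y) (expDecay_KAi_left ξ y)
    (fun v => hR v x) (fun v => hR v y)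
  have e : ∀ x y, ∫ l, KAi ξ x l * R l y ∂halfLine = ∫ l, R l y * KAi ξ l x ∂halfLine := by
    intro x y
    congr 1; ext l
    rw [KAi_comm ξ x, mul_comm]
  rw [hR x y, hR y x, KAi_comm ξ y x, e, e, this]

lemma eq_of_eq_const_mul_add_integral_KAi_mul (hne : ∃ x, Ai x ≠ 0)
    (hR : ∀ v w, R v w = KAi ξ v w + ∫ l, KAi ξ v l * R l w ∂halfLine)
    {a u : ℝ → ℝ} (ha : ExpDecay a) (hu : ExpDecay u) {D : ℝ}
    (h : ∀ x, u x = D * a x + ∫ l, KAi ξ x l * u l ∂halfLine) (y : ℝ) :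
    u y = D * (a y + ∫ z, R y z * a z ∂halfLine) := by
  have := integral_mul_eq_of_resolvent (ξ := ξ) hu (ha.const_mul D)
    (expDecay_of_resolvent hne fun v => hR v y)
    (expDecay_KAi_left ξ y) h (fun v => hR v y)
  rw [h y, mul_add]
  congr 1
  rw [← integral_const_mul]
  simp only [resolvent_comm hne hR y]
  simp only [KAi_comm ξ y, mul_comm (KAi ξ _ y), ← this]
  congr 1; ext z; ring

end Resolvent

open Matrix in
lemma abs_det_le_of_abs_le_one {n : ℕ} (M : Matrix (Fin n) (Fin n) ℝ) (h : ∀ i j, |M i j| ≤ 1) :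
    |M.det| ≤ √n ^ n := by
  let b := EuclideanSpace.basisFun (Fin n) ℝ
  have : Fact (Module.finrank ℝ (EuclideanSpace ℝ (Fin n)) = n) := ⟨by simp⟩
  have h1 := b.toBasis.orientation.abs_volumeForm_apply_le fun i => WithLp.toLp 2 (M i)
  rw [b.toBasis.orientation.volumeForm_robust b rfl, Module.Basis.det_apply] at h1
  have h2 : b.toBasis.toMatrix (fun i => WithLp.toLp 2 (M i)) = Mᵀ := by
    ext i j
    simp [Module.Basis.toMatrix_apply, b]
  rw [h2, det_transpose] at h1
  calc |M.det| ≤ ∏ i, ‖WithLp.toLp 2 (M i)‖ := h1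
    _ ≤ ∏ _i : Fin n, √n := by
      refine Finset.prod_le_prod (fun _ _ => norm_nonneg _) fun i _ => ?_
      rw [EuclideanSpace.norm_eq]
      refine Real.sqrt_le_sqrt ((Finset.sum_le_card_nsmul _ _ 1 fun j _ => ?_).trans_eq (by simp))
      simpa using h i j
    _ = √n ^ n := by simp

lemma abs_det_le_of_abs_le_mul {n : ℕ} (M : Matrix (Fin n) (Fin n) ℝ) (p q : Fin n → ℝ)
    (hp : ∀ i, 0 ≤ p i) (hq : ∀ i, 0 ≤ q i) (h : ∀ i j, |M i j| ≤ p i * q j) :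
    |M.det| ≤ √n ^ n * (∏ i, p i) * ∏ j, q j := by
  set N : Matrix (Fin n) (Fin n) ℝ := Matrix.of fun i j => M i j / (p i * q j) with hN
  have hM : M = Matrix.of fun i j => p i * (Matrix.of fun i j => q j * N i j) i j := by
    ext i j
    simp only [hN, Matrix.of_apply]
    rcases eq_or_ne (p i * q j) 0 with h0 | h0
    · have := h i j
      rw [h0] at this
      simp [h0, abs_nonpos_iff.1 this]
    · rw [← mul_assoc, mul_div_cancel₀ _ h0]
  have hN1 : |N.det| ≤ √n ^ n := abs_det_le_of_abs_le_one N fun i j => by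
    have hpq := mul_nonneg (hp i) (hq j)
    simp only [hN, Matrix.of_apply, abs_div, abs_of_nonneg hpq]
    exact div_le_one_of_le₀ (h i j) hpq
  have hP : 0 ≤ ∏ i, p i := Finset.prod_nonneg fun i _ => hp i
  have hQ : 0 ≤ ∏ i, q i := Finset.prod_nonneg fun i _ => hq i
  rw [hM, Matrix.det_mul_column, Matrix.det_mul_row, abs_mul, abs_mul, abs_of_nonneg hP,
    abs_of_nonneg hQ]
  calc _ ≤ (∏ i, p i) * ((∏ i, q i) * √n ^ n) := by gcongr
    _ = _ := by ring

/-- The Hadamard weight `(n + 1) ^ ((n + 1) / 2)`. -/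
noncomputable def hadamardWeight (n : ℕ) : ℝ := √((n + 1 : ℕ) : ℝ) ^ (n + 1)

lemma hadamardWeight_nonneg (n : ℕ) : 0 ≤ hadamardWeight n := by
  unfold hadamardWeight; positivity

lemma sqrt_pow_le_hadamardWeight (n : ℕ) : √(n : ℝ) ^ n ≤ hadamardWeight n := by
  unfold hadamardWeight
  have h1 : √(n : ℝ) ≤ √((n + 1 : ℕ) : ℝ) := Real.sqrt_le_sqrt (by push_cast; linarith)
  have h2 : 1 ≤ √((n + 1 : ℕ) : ℝ) :=
    Real.one_le_sqrt.2 (by push_cast; linarith [n.cast_nonneg (α := ℝ)])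
  calc √(n : ℝ) ^ n ≤ √((n + 1 : ℕ) : ℝ) ^ n := by gcongr
    _ ≤ _ := pow_le_pow_right₀ h2 n.le_succ

lemma sq_hadamardWeight_le (n : ℕ) :
    hadamardWeight n ^ 2 ≤ Real.exp 1 ^ (n + 1) * (n + 1).factorial := by
  have h := Real.pow_div_factorial_le_exp ((n + 1 : ℕ) : ℝ) (by positivity) (n + 1)
  rw [div_le_iff₀ (by positivity)] at h
  rw [hadamardWeight, ← pow_mul, mul_comm (n + 1) 2, pow_mul, Real.sq_sqrt (by positivity),
    ← Real.exp_nat_mul, mul_one]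
  exact h

lemma factorial_add_le (n k : ℕ) :
    ((n + k).factorial : ℝ) ≤ n.factorial * (k.factorial * 2 ^ (n + k)) := by
  rw [← Nat.add_choose_mul_factorial_mul_factorial]
  have h : (((n + k).choose k : ℕ) : ℝ) ≤ 2 ^ (n + k) := by
    exact_mod_cast Nat.choose_le_two_pow _ _
  push_cast
  calc _ ≤ (2 : ℝ) ^ (n + k) * n.factorial * k.factorial := by gcongr
    _ = _ := by ring

lemma summable_hadamardWeight (k : ℕ) {T : ℝ} (hT : 0 ≤ T) :
    Summable fun n : ℕ => hadamardWeight (n + k) * T ^ n / n.factorial := by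
  set A : ℝ := Real.exp 1 ^ (k + 1) * ((k + 1).factorial * 2 ^ (k + 1)) with hA
  have h1 : Summable fun n : ℕ => A * ((8 * Real.exp 1 * T ^ 2) ^ n / n.factorial) +
      ((1 / 4 : ℝ) ^ n) :=
    ((Real.summable_pow_div_factorial _).mul_left A).add
      (summable_geometric_of_lt_one (by norm_num) (by norm_num))
  refine Summable.of_nonneg_of_le
    (fun n => by have := hadamardWeight_nonneg (n + k); positivity) (fun n => ?_) h1
  have hw := sq_hadamardWeight_le (n + k)
  have hf := factorial_add_le n (k + 1)
  have hw' : hadamardWeight (n + k) ^ 2 ≤ A * (2 * Real.exp 1) ^ n * n.factorial := by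
    calc _ ≤ _ := hw
      _ ≤ Real.exp 1 ^ (n + k + 1) * (n.factorial * ((k + 1).factorial * 2 ^ (n + (k + 1)))) := by
        gcongr; exact hf
      _ = _ := by rw [hA]; ring
  set w := hadamardWeight (n + k)
  have hfac : (0 : ℝ) < n.factorial := by positivity
  have h2 : (w * (2 * T) ^ n / n.factorial) ^ 2 ≤
      A * ((8 * Real.exp 1 * T ^ 2) ^ n / n.factorial) := by
    rw [div_pow, mul_pow, div_le_iff₀ (by positivity)]
    calc w ^ 2 * ((2 * T) ^ n) ^ 2
        ≤ (A * (2 * Real.exp 1) ^ n * n.factorial) * ((2 * T) ^ n) ^ 2 := by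
          gcongr
      _ = A * (((2 * Real.exp 1) * (2 * T) ^ 2) ^ n) * n.factorial := by
        rw [mul_pow _ ((2 * T) ^ 2), ← pow_mul, ← pow_mul, mul_comm 2 n]; ring
      _ = A * ((8 * Real.exp 1 * T ^ 2) ^ n) * n.factorial := by ring_nf
      _ = _ := by field_simp
  have h3 : ((1 / 2 : ℝ) ^ n) ^ 2 = (1 / 4) ^ n := by rw [← pow_mul, mul_comm, pow_mul]; norm_num
  have h4 : w * T ^ n / n.factorial = (w * (2 * T) ^ n / n.factorial) * (1 / 2) ^ n := by
    rw [mul_pow, one_div, inv_pow]; field_simp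
  rw [h4]
  have hw0 : 0 ≤ (w * (2 * T) ^ n / n.factorial) := by
    have := hadamardWeight_nonneg (n + k); positivity
  nlinarith [sq_nonneg ((w * (2 * T) ^ n / n.factorial) - (1 / 2) ^ n), hw0]

/-- Sequences growing at most like the Hadamard weights times a geometric factor. -/
def HadamardGrowth (A T : ℝ) (d : ℕ → ℝ) : Prop :=
  ∀ n, |d n| ≤ A * (hadamardWeight n * T ^ n)

/-- The `k`-th term shift of the alternating exponential series. -/
noncomputable def altTerm (k : ℕ) (d : ℕ → ℝ) (n : ℕ) : ℝ :=
  (-1) ^ (n + k) / n.factorial * d (n + k)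

/-- The `k`-th shifted alternating exponential series. -/
noncomputable def altSum (k : ℕ) (d : ℕ → ℝ) : ℝ := ∑' n, altTerm k d n

/-- The total weight majorizing a shifted alternating series. -/
noncomputable def altMajorant (k : ℕ) (T : ℝ) (n : ℕ) : ℝ :=
  T ^ k * (hadamardWeight (n + k) * T ^ n / n.factorial)

lemma summable_altMajorant (k : ℕ) {T : ℝ} (hT : 0 ≤ T) : Summable (altMajorant k T) :=
  (summable_hadamardWeight k hT).mul_left _

lemma abs_altTerm_le {A T : ℝ} {d : ℕ → ℝ} (h : HadamardGrowth A T d) (k n : ℕ) :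
    |altTerm k d n| ≤ A * altMajorant k T n := by
  rw [altTerm, altMajorant, abs_mul, abs_div, abs_pow, abs_neg, abs_one, one_pow, Nat.abs_cast]
  calc _ ≤ 1 / (n.factorial : ℝ) * (A * (hadamardWeight (n + k) * T ^ (n + k))) := by
        gcongr; exact h _
    _ = _ := by rw [pow_add]; ring

lemma summable_altTerm {A T : ℝ} (hT : 0 ≤ T) {d : ℕ → ℝ} (h : HadamardGrowth A T d) (k : ℕ) :
    Summable (altTerm k d) :=
  .of_norm_bounded ((summable_altMajorant k hT).mul_left A) (abs_altTerm_le h k)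

lemma abs_altSum_le {A T : ℝ} (hT : 0 ≤ T) {d : ℕ → ℝ} (h : HadamardGrowth A T d) (k : ℕ) :
    |altSum k d| ≤ A * ∑' n, altMajorant k T n := by
  rw [← tsum_mul_left]
  rw [← Real.norm_eq_abs]
  exact tsum_of_norm_bounded ((summable_altMajorant k hT).mul_left A).hasSum (abs_altTerm_le h k)

section Recursion

variable {A B C T : ℝ} {d U W : ℕ → ℝ} {g : ℝ}

lemma altSum_zero_eq (hT : 0 ≤ T) (hd : HadamardGrowth A T d) (hU : HadamardGrowth B T U)
    (hW : HadamardGrowth C T W) (h0 : U 0 = g * d 0)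
    (h : ∀ n, U (n + 1) = g * d (n + 1) - (n + 1) * W n) :
    altSum 0 U = g * altSum 0 d + altSum 0 W := by
  have sd := summable_altTerm hT hd 0
  have sU := summable_altTerm hT hU 0
  have e : ∀ n, altTerm 0 U (n + 1) = g * altTerm 0 d (n + 1) + altTerm 0 W n := by
    intro n
    simp only [altTerm, add_zero, h, Nat.factorial_succ]
    have : (n.factorial : ℝ) ≠ 0 := by positivity
    have : (n + 1 : ℝ) ≠ 0 := by positivity
    push_cast
    field_simp
    ring
  rw [altSum, altSum, altSum, sU.tsum_eq_zero_add, sd.tsum_eq_zero_add]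
  simp only [e]
  rw [(((summable_nat_add_iff 1).2 sd).mul_left g).tsum_add (summable_altTerm hT hW 0),
    tsum_mul_left]
  have : altTerm 0 U 0 = g * altTerm 0 d 0 := by simp [altTerm, h0]
  rw [this]
  ring

lemma altSum_succ_eq (hT : 0 ≤ T) (hd : HadamardGrowth A T d) (hU : HadamardGrowth B T U)
    (hW : HadamardGrowth C T W) (h : ∀ n, U (n + 1) = g * d (n + 1) - (n + 1) * W n) (k : ℕ) :
    altSum (k + 1) U = g * altSum (k + 1) d + altSum (k + 1) W + (k + 1) * altSum k W := by
  have sd := summable_altTerm hT hd (k + 1)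
  have sU := summable_altTerm hT hU (k + 1)
  have sW := summable_altTerm hT hW k
  have sW' := summable_altTerm hT hW (k + 1)
  have e : ∀ n, altTerm (k + 1) U (n + 1) = g * altTerm (k + 1) d (n + 1) +
      altTerm (k + 1) W n + (k + 1) * altTerm k W (n + 1) := by
    intro n
    simp only [altTerm, ← add_assoc, h, Nat.factorial_succ]
    rw [show n + 1 + k = n + k + 1 by ring]
    have : (n.factorial : ℝ) ≠ 0 := by positivity
    have : (n + 1 : ℝ) ≠ 0 := by positivity
    push_cast
    field_simp
    ring
  have sdg := ((summable_nat_add_iff 1).2 sd).mul_left g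
  have sWk := ((summable_nat_add_iff 1).2 sW).mul_left (k + 1 : ℝ)
  rw [altSum, altSum, altSum, altSum, sU.tsum_eq_zero_add, sd.tsum_eq_zero_add,
    sW.tsum_eq_zero_add]
  simp only [e]
  rw [(sdg.add sW').tsum_add sWk, sdg.tsum_add sW', tsum_mul_left, tsum_mul_left]
  have : altTerm (k + 1) U 0 = g * altTerm (k + 1) d 0 + (k + 1) * altTerm k W 0 := by
    simp only [altTerm, zero_add, h]
    simp
    ring
  rw [this]
  ring

end Recursion

lemma sum_antidiagonal_pow_div_factorial (x y : ℝ) (n : ℕ) :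
    ∑ m ∈ Finset.HasAntidiagonal.antidiagonal n,
        x ^ m.1 * y ^ m.2 / (m.1.factorial * m.2.factorial) =
      (x + y) ^ n / n.factorial := by
  rw [(Commute.all x y).add_pow', Finset.sum_div]
  refine Finset.sum_congr rfl fun m hm => ?_
  rw [Finset.HasAntidiagonal.mem_antidiagonal] at hm
  subst hm
  have h := Nat.add_choose_mul_factorial_mul_factorial m.1 m.2
  rw [← Nat.choose_symm_add] at h
  rw [← h, nsmul_eq_mul]
  have h1 : ((m.1 + m.2).choose m.1 : ℝ) ≠ 0 := by
    exact_mod_cast (Nat.choose_pos (Nat.le_add_right _ _)).ne'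
  have h2 : (m.1.factorial : ℝ) ≠ 0 := by positivity
  have h3 : (m.2.factorial : ℝ) ≠ 0 := by positivity
  push_cast
  field_simp

/-- If all shifted alternating series vanish, then so does the initial term. -/
lemma eq_zero_of_altSum_eq_zero {A T : ℝ} (hT : 0 ≤ T) {d : ℕ → ℝ}
    (hd : HadamardGrowth A T d) (h : ∀ k, altSum k d = 0) : d 0 = 0 := by
  set f : ℕ × ℕ → ℝ := fun p => (-1) ^ p.1 / p.1.factorial * altTerm p.1 d p.2 with hf
  have hf' : ∀ p : ℕ × ℕ, f p = d (p.1 + p.2) * (1 ^ p.1 * (-1) ^ p.2 /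
      (p.1.factorial * p.2.factorial)) := by
    intro p
    have h2 : ((-1 : ℝ) ^ p.1) * (-1) ^ p.1 = 1 := by rw [← mul_pow]; simp
    simp only [hf, altTerm, pow_add, add_comm p.1]
    rw [one_pow, one_mul]
    calc _ = d (p.2 + p.1) * ((-1) ^ p.2 / (p.1.factorial * p.2.factorial)) *
          ((-1 : ℝ) ^ p.1 * (-1) ^ p.1) := by ring
      _ = _ := by rw [h2, mul_one]
  have hsig : ∀ (F : ℕ × ℕ → ℝ) (n : ℕ), (∑' m : Finset.HasAntidiagonal.antidiagonal n, F m) =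
      ∑ m ∈ Finset.HasAntidiagonal.antidiagonal n, F m := fun F n => Finset.tsum_subtype _ _
  have hsum : Summable fun p : (Σ n : ℕ, Finset.HasAntidiagonal.antidiagonal n) => |f p.2| := by
    refine (summable_sigma_of_nonneg fun _ => abs_nonneg _).2
      ⟨fun n => (hasSum_fintype _).summable, ?_⟩
    have e : ∀ n, ∑' m : Finset.HasAntidiagonal.antidiagonal n, |f m| =
        |d n| * (2 ^ n / n.factorial) := by
      intro n
      rw [hsig (fun m => |f m|), ← one_add_one_eq_two, ← sum_antidiagonal_pow_div_factorial,
        Finset.mul_sum]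
      refine Finset.sum_congr rfl fun m hm => ?_
      rw [Finset.HasAntidiagonal.mem_antidiagonal] at hm
      rw [hf', hm, abs_mul, abs_div, abs_mul, abs_mul]
      simp
    simp only [e]
    refine Summable.of_nonneg_of_le (fun n => by positivity) (fun n => ?_)
      ((summable_hadamardWeight 0 (by positivity : 0 ≤ 2 * T)).mul_left A)
    calc |d n| * (2 ^ n / n.factorial)
        ≤ A * (hadamardWeight n * T ^ n) * (2 ^ n / n.factorial) := by
          gcongr; exact hd n
      _ = _ := by rw [mul_pow, add_zero]; ring
  have hsum' : Summable fun p : (Σ n : ℕ, Finset.HasAntidiagonal.antidiagonal n) => f p.2 :=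
    hsum.of_abs
  have hsf : Summable f := Finset.HasAntidiagonal.sigmaAntidiagonalEquivProd.summable_iff.1 hsum'
  have e1 : ∑' p, f p = 0 := by
    rw [hsf.tsum_prod]
    simp only [hf, tsum_mul_left]
    refine (tsum_congr fun k => ?_).trans tsum_zero
    rw [← altSum, h k, mul_zero]
  have e2 : ∑' p, f p = d 0 := by
    rw [← Finset.HasAntidiagonal.sigmaAntidiagonalEquivProd.tsum_eq f]
    refine (Summable.tsum_sigma' (fun n => (hasSum_fintype _).summable) hsum').trans ?_
    have e : ∀ n, ∑' m : Finset.HasAntidiagonal.antidiagonal n, f m =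
        d n * (0 ^ n / n.factorial) := by
      intro n
      rw [hsig f, ← add_neg_cancel (1 : ℝ), ← sum_antidiagonal_pow_div_factorial, Finset.mul_sum]
      refine Finset.sum_congr rfl fun m hm => ?_
      rw [Finset.HasAntidiagonal.mem_antidiagonal] at hm
      rw [hf', hm]
    refine (tsum_congr e).trans ((tsum_eq_single 0 fun n hn => ?_).trans ?_)
    · simp [hn]
    · simp
  rw [← e2, e1]

/-- The matrix of values of a kernel at a tuple of points. -/
def kernelMatrix (K : ℝ → ℝ → ℝ) {n : ℕ} (x : Fin n → ℝ) : Matrix (Fin n) (Fin n) ℝ :=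
  Matrix.of fun i j => K (x i) (x j)

/-- The kernel matrix with its `j`-th column replaced by the values of `g`. -/
def replacedMatrix (K : ℝ → ℝ → ℝ) (g : ℝ → ℝ) {n : ℕ} (j : Fin n) (x : Fin n → ℝ) :
    Matrix (Fin n) (Fin n) ℝ :=
  (kernelMatrix K x).updateCol j fun i => g (x i)

lemma replacedMatrix_apply (K : ℝ → ℝ → ℝ) (g : ℝ → ℝ) {n : ℕ} (j : Fin n) (x : Fin n → ℝ)
    (i k : Fin n) :
    replacedMatrix K g j x i k = if k = j then g (x i) else K (x i) (x k) := by
  simp [replacedMatrix, kernelMatrix, Matrix.updateCol_apply]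

lemma det_replacedMatrix_comp_perm (K : ℝ → ℝ → ℝ) (g : ℝ → ℝ) {n : ℕ} (x : Fin n → ℝ)
    (σ : Equiv.Perm (Fin n)) (j : Fin n) :
    (replacedMatrix K g j (x ∘ σ)).det = (replacedMatrix K g (σ j) x).det := by
  rw [← Matrix.det_submatrix_equiv_self σ (replacedMatrix K g (σ j) x)]
  congr 1
  ext i k
  simp [replacedMatrix_apply]

lemma det_replacedMatrix_insertNth (K : ℝ → ℝ → ℝ) (g : ℝ → ℝ) {n : ℕ} (j : Fin (n + 1)) (y : ℝ)
    (x : Fin n → ℝ) :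
    (replacedMatrix K g j (j.insertNth (α := fun _ => ℝ) y x)).det =
      (replacedMatrix K g 0 (Fin.cons y x : Fin (n + 1) → ℝ)).det := by
  have h : (j.insertNth (α := fun _ => ℝ) y x) =
      (Fin.cons y x : Fin (n + 1) → ℝ) ∘ j.cycleRange := by
    rw [Fin.cons_comp_cycleRange]
  rw [h, det_replacedMatrix_comp_perm, Fin.cycleRange_self]

lemma det_replacedMatrix_cons (K : ℝ → ℝ → ℝ) (g : ℝ → ℝ) {n : ℕ} (y : ℝ) (x : Fin n → ℝ) :
    (replacedMatrix K g 0 (Fin.cons y x : Fin (n + 1) → ℝ)).det =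
      g y * (kernelMatrix K x).det - ∑ j, K y (x j) * (replacedMatrix K g j x).det := by
  rw [Matrix.det_succ_row_zero, Fin.sum_univ_succ, sub_eq_add_neg, ← Finset.sum_neg_distrib]
  congr 1
  · simp only [replacedMatrix_apply]
    simp only [Fin.val_zero, pow_zero, one_mul, if_true, Fin.cons_zero]
    congr 2
  · refine Finset.sum_congr rfl fun j _ => ?_
    have hsub : ((replacedMatrix K g 0 (Fin.cons y x : Fin (n + 1) → ℝ)).submatrix Fin.succ
        j.succ.succAbove).submatrix id j.cycleRange = replacedMatrix K g j x := by
      ext i k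
      simp only [Matrix.submatrix_apply, Fin.succAbove_cycleRange, id, replacedMatrix_apply,
        Fin.cons_succ]
      rcases eq_or_ne k j with rfl | hk
      · simp
      · rw [Equiv.swap_apply_of_ne_of_ne (Fin.succ_ne_zero _) (by simpa using hk)]
        simp [hk]
    rw [← hsub, Matrix.det_permute', Fin.sign_cycleRange]
    have h2 : ((-1 : ℝ) ^ (j : ℕ)) * (-1) ^ (j : ℕ) = 1 := by rw [← mul_pow]; simp
    have h3 : replacedMatrix K g 0 (Fin.cons y x : Fin (n + 1) → ℝ) 0 j.succ = K y (x j) := by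
      simp [replacedMatrix_apply]
    rw [h3, Fin.val_succ, pow_succ]
    push_cast
    ring

lemma replacedMatrix_self (K : ℝ → ℝ → ℝ) {n : ℕ} (y : ℝ) (x : Fin n → ℝ) :
    replacedMatrix K (fun z => K z y) 0 (Fin.cons y x : Fin (n + 1) → ℝ) =
      kernelMatrix K (Fin.cons y x : Fin (n + 1) → ℝ) := by
  ext i k
  rw [replacedMatrix_apply]
  split_ifs with h
  · subst h; simp [kernelMatrix]
  · rfl

/-- The product measure of `n` half lines. -/
noncomputable abbrev halfSpace (n : ℕ) : Measure (Fin n → ℝ) := Measure.pi fun _ => halfLine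

/-- The product of the squared exponential weights. -/
noncomputable def expWeight {n : ℕ} (x : Fin n → ℝ) : ℝ := ∏ i, Real.exp (-2 * x i)

lemma integrable_expWeight (n : ℕ) : Integrable (expWeight (n := n)) (halfSpace n) :=
  Integrable.fintype_prod fun _ => integrable_exp_neg_two

lemma expWeight_nonneg {n : ℕ} (x : Fin n → ℝ) : 0 ≤ expWeight x :=
  Finset.prod_nonneg fun _ _ => (Real.exp_pos _).le

lemma integral_expWeight_le (n : ℕ) : ∫ x, expWeight (n := n) x ∂halfSpace n ≤ 1 := by
  have := integral_fintype_prod_eq_pow (ι := Fin n) (μ := halfLine) (fun s : ℝ => Real.exp (-2 * s))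
  simp only [expWeight, halfSpace, this, integral_exp_neg_two]
  exact pow_le_one₀ (by norm_num) (by norm_num)

lemma expWeight_cons {n : ℕ} (y : ℝ) (x : Fin n → ℝ) :
    expWeight (Fin.cons y x : Fin (n + 1) → ℝ) = Real.exp (-2 * y) * expWeight x := by
  simp [expWeight, Fin.prod_univ_succ]

lemma expWeight_eq {n : ℕ} (x : Fin n → ℝ) :
    expWeight x = (∏ i, Real.exp (-x i)) * ∏ i, Real.exp (-x i) := by
  rw [← Finset.prod_mul_distrib]
  refine Finset.prod_congr rfl fun i _ => ?_
  rw [← Real.exp_add]; ring_nf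

/-- Continuous kernels on the half line with product exponential decay. -/
structure DecayKernel (K : ℝ → ℝ → ℝ) (C : ℝ) : Prop where
  continuous : Continuous fun p : ℝ × ℝ => K p.1 p.2
  nonneg : 0 ≤ C
  bound : ∀ x y, |K x y| ≤ C * (Real.exp (-x) * Real.exp (-y))

/-- Continuous functions with exponential decay. -/
structure DecayFun (g : ℝ → ℝ) (C : ℝ) : Prop where
  continuous : Continuous g
  bound : ∀ x, |g x| ≤ C * Real.exp (-x)

section Bounds

variable {K : ℝ → ℝ → ℝ} {g : ℝ → ℝ} {C : ℝ} {n : ℕ}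

lemma DecayKernel.mono (hK : DecayKernel K C) {C' : ℝ} (h : C ≤ C') : DecayKernel K C' :=
  ⟨hK.continuous, hK.nonneg.trans h, fun x y => (hK.bound x y).trans (by gcongr)⟩

lemma DecayFun.mono (hg : DecayFun g C) {C' : ℝ} (h : C ≤ C') : DecayFun g C' :=
  ⟨hg.continuous, fun x => (hg.bound x).trans (by gcongr)⟩

lemma DecayKernel.continuous_comp (hK : DecayKernel K C) {X : Type*} [TopologicalSpace X]
    {f h : X → ℝ} (hf : Continuous f) (hh : Continuous h) : Continuous fun x => K (f x) (h x) :=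
  ContinuousOn.comp_continuous (f := fun x => (f x, h x)) hK.continuous.continuousOn
    (by fun_prop) (s := Set.univ) (by simp)

lemma DecayKernel.continuous_det (hK : DecayKernel K C) :
    Continuous fun x : Fin n → ℝ => (kernelMatrix K x).det :=
  Continuous.matrix_det (continuous_matrix fun i j =>
    hK.continuous_comp (continuous_apply i) (continuous_apply j))

lemma DecayKernel.continuous_det_replaced (hK : DecayKernel K C) (hg : DecayFun g C) (j : Fin n) :
    Continuous fun x : Fin n → ℝ => (replacedMatrix K g j x).det := by
  refine Continuous.matrix_det (continuous_matrix fun i k => ?_)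
  simp only [replacedMatrix_apply]
  split_ifs
  · exact hg.continuous.comp (continuous_apply i)
  · exact hK.continuous_comp (continuous_apply i) (continuous_apply k)

lemma DecayKernel.abs_det_le (hK : DecayKernel K C) (x : Fin n → ℝ) :
    |(kernelMatrix K x).det| ≤ √n ^ n * C ^ n * expWeight x := by
  refine (abs_det_le_of_abs_le_mul _ (fun i => Real.exp (-x i)) (fun j => C * Real.exp (-x j))
    (fun i => (Real.exp_pos _).le) (fun j => mul_nonneg hK.nonneg (Real.exp_pos _).le)
    fun i j => (hK.bound _ _).trans_eq (by ring)).trans_eq ?_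
  rw [Finset.prod_mul_distrib, Finset.prod_const, expWeight_eq]
  simp
  ring

lemma DecayKernel.abs_det_replaced_le (hK : DecayKernel K C) (hg : DecayFun g C) (j : Fin n)
    (x : Fin n → ℝ) :
    |(replacedMatrix K g j x).det| ≤ √n ^ n * C ^ n * (Real.exp (x j) * expWeight x) := by
  have h : |(replacedMatrix K (fun z => Real.exp (-x j) * g z) j x).det| ≤
      √n ^ n * C ^ n * expWeight x := by
    refine (abs_det_le_of_abs_le_mul _ (fun i => Real.exp (-x i)) (fun j => C * Real.exp (-x j))
      (fun i => (Real.exp_pos _).le) (fun j => mul_nonneg hK.nonneg (Real.exp_pos _).le)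
      fun i k => ?_).trans_eq ?_
    · rw [replacedMatrix_apply]
      split_ifs with hk
      · subst hk
        rw [abs_mul, abs_of_pos (Real.exp_pos _)]
        calc _ ≤ Real.exp (-x k) * (C * Real.exp (-x i)) := by gcongr; exact hg.bound _
          _ = _ := by ring
      · exact (hK.bound _ _).trans_eq (by ring)
    · rw [Finset.prod_mul_distrib, Finset.prod_const, expWeight_eq]
      simp
      ring
  have e : (replacedMatrix K (fun z => Real.exp (-x j) * g z) j x).det =
      Real.exp (-x j) * (replacedMatrix K g j x).det :=
    Matrix.det_updateCol_smul (kernelMatrix K x) j (Real.exp (-x j)) fun i => g (x i)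
  rw [e, abs_mul, abs_of_pos (Real.exp_pos _), Real.exp_neg] at h
  calc _ = Real.exp (x j) * ((Real.exp (x j))⁻¹ * |(replacedMatrix K g j x).det|) := by
        field_simp
    _ ≤ Real.exp (x j) * (√n ^ n * C ^ n * expWeight x) := by gcongr
    _ = _ := by ring

lemma DecayKernel.abs_det_replaced_cons_le (hK : DecayKernel K C) (hg : DecayFun g C)
    (y : ℝ) (x : Fin n → ℝ) :
    |(replacedMatrix K g 0 (Fin.cons y x : Fin (n + 1) → ℝ)).det| ≤
      hadamardWeight n * C ^ (n + 1) * (Real.exp (-y) * expWeight x) := by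
  refine (hK.abs_det_replaced_le hg 0 _).trans_eq ?_
  rw [expWeight_cons, Fin.cons_zero, ← mul_assoc (Real.exp y), ← Real.exp_add, hadamardWeight]
  ring_nf

end Bounds

lemma integral_halfSpace_succ {n : ℕ} (j : Fin (n + 1)) {F : (Fin (n + 1) → ℝ) → ℝ}
    (hF : Integrable F (halfSpace (n + 1))) :
    ∫ x, F x ∂halfSpace (n + 1) =
      ∫ y, ∫ x, F (j.insertNth (α := fun _ => ℝ) y x) ∂halfSpace n ∂halfLine := by
  have hmp := (measurePreserving_piFinSuccAbove (fun _ : Fin (n + 1) => halfLine) j).symm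
  rw [← hmp.integral_comp']
  exact integral_prod _ (hmp.integrable_comp_of_integrable hF)

/-- The `n`-th Fredholm minor of a kernel on the half line. -/
noncomputable def kernelMinor (K : ℝ → ℝ → ℝ) (n : ℕ) : ℝ :=
  ∫ x, (kernelMatrix K x).det ∂halfSpace n

/-- The `n`-th Fredholm minor with the first column replaced by a function. -/
noncomputable def columnMinor (K : ℝ → ℝ → ℝ) (g : ℝ → ℝ) (n : ℕ) (y : ℝ) : ℝ :=
  ∫ x, (replacedMatrix K g 0 (Fin.cons y x : Fin (n + 1) → ℝ)).det ∂halfSpace n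

section Minors

variable {K : ℝ → ℝ → ℝ} {f g : ℝ → ℝ} {C C' : ℝ} {n : ℕ}

lemma DecayKernel.integrable_det (hK : DecayKernel K C) :
    Integrable (fun x : Fin n → ℝ => (kernelMatrix K x).det) (halfSpace n) :=
  ((integrable_expWeight n).const_mul (√n ^ n * C ^ n)).mono'
    hK.continuous_det.aestronglyMeasurable (Eventually.of_forall hK.abs_det_le)

lemma DecayKernel.abs_mul_det_replaced_le (hK : DecayKernel K C) (hg : DecayFun g C)
    (hf : DecayFun f C') (j : Fin n) (x : Fin n → ℝ) :
    |f (x j) * (replacedMatrix K g j x).det| ≤ C' * (√n ^ n * C ^ n) * expWeight x := by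
  rw [abs_mul]
  have hw := expWeight_nonneg x
  have hC := hK.nonneg
  calc _ ≤ (C' * Real.exp (-x j)) * (√n ^ n * C ^ n * (Real.exp (x j) * expWeight x)) :=
        mul_le_mul (hf.bound _) (hK.abs_det_replaced_le hg j x) (abs_nonneg _)
          ((abs_nonneg _).trans (hf.bound _))
    _ = C' * (√n ^ n * C ^ n) * (Real.exp (-x j) * Real.exp (x j)) * expWeight x := by ring
    _ = _ := by rw [← Real.exp_add, neg_add_cancel, Real.exp_zero, mul_one]

lemma DecayKernel.integrable_mul_det_replaced (hK : DecayKernel K C) (hg : DecayFun g C)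
    (hf : DecayFun f C') (j : Fin n) :
    Integrable (fun x : Fin n → ℝ => f (x j) * (replacedMatrix K g j x).det) (halfSpace n) :=
  ((integrable_expWeight n).const_mul _).mono'
    ((hf.continuous.comp (continuous_apply j)).mul
      (hK.continuous_det_replaced hg j)).aestronglyMeasurable
    (Eventually.of_forall (hK.abs_mul_det_replaced_le hg hf j))

lemma DecayKernel.integral_mul_det_replaced (hK : DecayKernel K C) (hg : DecayFun g C)
    (hf : DecayFun f C') (j : Fin (n + 1)) :
    ∫ x, f (x j) * (replacedMatrix K g j x).det ∂halfSpace (n + 1) =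
      ∫ y, f y * columnMinor K g n y ∂halfLine := by
  rw [integral_halfSpace_succ j (hK.integrable_mul_det_replaced hg hf j)]
  simp only [det_replacedMatrix_insertNth, Fin.insertNth_apply_same, integral_const_mul,
    columnMinor]

lemma DecayKernel.kernelMinor_succ (hK : DecayKernel K C) :
    kernelMinor K (n + 1) = ∫ y, columnMinor K (fun z => K z y) n y ∂halfLine := by
  rw [kernelMinor, integral_halfSpace_succ 0 hK.integrable_det]
  simp only [columnMinor, replacedMatrix_self, Fin.insertNth_zero']

lemma kernelMinor_zero : kernelMinor K 0 = 1 := by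
  simp [kernelMinor, halfSpace, measureReal_def]

lemma columnMinor_zero (y : ℝ) : columnMinor K g 0 y = g y * kernelMinor K 0 := by
  simp only [columnMinor, det_replacedMatrix_cons, kernelMinor]
  simp [mul_comm]

lemma DecayKernel.decayFun (hK : DecayKernel K C) (y : ℝ) :
    DecayFun (fun l => K y l) (C * Real.exp (-y)) :=
  ⟨hK.continuous_comp continuous_const continuous_id,
    fun l => (hK.bound y l).trans_eq (by ring)⟩

lemma DecayKernel.columnMinor_succ (hK : DecayKernel K C) (hg : DecayFun g C) (y : ℝ) :
    columnMinor K g (n + 1) y = g y * kernelMinor K (n + 1) -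
      (n + 1) * ∫ l, K y l * columnMinor K g n l ∂halfLine := by
  rw [columnMinor]
  simp only [det_replacedMatrix_cons]
  rw [integral_sub (hK.integrable_det.const_mul _) (integrable_finsetSum _ fun j _ =>
    hK.integrable_mul_det_replaced hg (hK.decayFun y) j), integral_const_mul,
    integral_finsetSum _ fun j _ => hK.integrable_mul_det_replaced hg (hK.decayFun y) j]
  simp only [hK.integral_mul_det_replaced hg (hK.decayFun y)]
  simp [kernelMinor, columnMinor]

lemma DecayKernel.abs_kernelMinor_le (hK : DecayKernel K C) (n : ℕ) :
    |kernelMinor K n| ≤ √n ^ n * C ^ n := by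
  have hC := hK.nonneg
  rw [← Real.norm_eq_abs, kernelMinor]
  refine (norm_integral_le_of_norm_le ((integrable_expWeight n).const_mul (√n ^ n * C ^ n))
    (Eventually.of_forall hK.abs_det_le)).trans ?_
  rw [integral_const_mul]
  exact mul_le_of_le_one_right (by positivity) (integral_expWeight_le n)

lemma DecayKernel.growth_kernelMinor (hK : DecayKernel K C) :
    HadamardGrowth 1 C (kernelMinor K) := fun n => by
  have hC := hK.nonneg
  rw [one_mul]
  exact (hK.abs_kernelMinor_le n).trans (by gcongr; exact sqrt_pow_le_hadamardWeight n)

lemma DecayKernel.growth_columnMinor (hK : DecayKernel K C) (hg : DecayFun g C) (y : ℝ) :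
    HadamardGrowth (C * Real.exp (-y)) C fun n => columnMinor K g n y := fun n => by
  have hC := hK.nonneg
  have hw := hadamardWeight_nonneg n
  simp only [columnMinor]
  rw [← Real.norm_eq_abs]
  refine (norm_integral_le_of_norm_le ((integrable_expWeight n).const_mul
    (hadamardWeight n * C ^ (n + 1) * Real.exp (-y)))
    (Eventually.of_forall fun x => (hK.abs_det_replaced_cons_le hg y x).trans_eq
      (by ring))).trans ?_
  rw [integral_const_mul]
  refine (mul_le_of_le_one_right (by positivity) (integral_expWeight_le n)).trans_eq ?_
  ring

lemma DecayKernel.measurable_columnMinor (hK : DecayKernel K C) (hg : DecayFun g C) :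
    StronglyMeasurable (columnMinor K g n) := by
  have h : Continuous fun p : ℝ × (Fin n → ℝ) =>
      (replacedMatrix K g 0 (Fin.cons p.1 p.2 : Fin (n + 1) → ℝ)).det :=
    (hK.continuous_det_replaced hg 0).comp (Continuous.finCons continuous_fst continuous_snd)
  exact h.stronglyMeasurable.integral_prod_right'

/-- The Fredholm series of column minors. -/
noncomputable def columnSeries (K : ℝ → ℝ → ℝ) (g : ℝ → ℝ) (k : ℕ) (y : ℝ) : ℝ :=
  altSum k fun n => columnMinor K g n y

lemma DecayKernel.abs_altTerm_columnMinor_le (hK : DecayKernel K C) (hg : DecayFun g C)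
    (k m : ℕ) (y : ℝ) :
    |altTerm k (fun n => columnMinor K g n y) m| ≤ C * altMajorant k C m * Real.exp (-y) :=
  (abs_altTerm_le (hK.growth_columnMinor hg y) k m).trans_eq (by ring)

lemma DecayKernel.expDecay_columnSeries (hK : DecayKernel K C) (hg : DecayFun g C) (k : ℕ) :
    ExpDecay (columnSeries K g k) := by
  have hC := hK.nonneg
  refine ⟨?_, C * ∑' n, altMajorant k C n, mul_nonneg hC (tsum_nonneg fun n => ?_), fun y => ?_⟩
  · have hterm : ∀ y, HasSum (fun m => altTerm k (fun n => columnMinor K g n y) m)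
        (columnSeries K g k y) := fun y =>
      (summable_altTerm hC (hK.growth_columnMinor hg y) k).hasSum
    refine (aestronglyMeasurable_of_tendsto_ae (u := atTop)
      (f := fun N y => ∑ m ∈ Finset.range N, altTerm k (fun n => columnMinor K g n y) m)
      (fun N => ?_) (Eventually.of_forall fun y => (hterm y).tendsto_sum_nat))
    refine Finset.aestronglyMeasurable_fun_sum _ fun m _ => ?_
    exact ((hK.measurable_columnMinor hg).const_mul _).aestronglyMeasurable
  · have := hadamardWeight_nonneg (n + k)
    unfold altMajorant; positivity
  · exact (abs_altSum_le hC (hK.growth_columnMinor hg y) k).trans_eq (by ring)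

/-- Term-by-term integration of a series of column minors against a decaying function. -/
lemma hasSum_integral_of_decay {v : ℕ → ℝ → ℝ} {b : ℕ → ℝ} (hb : Summable b)
    (hm : ∀ n, AEStronglyMeasurable (v n) halfLine)
    (hv : ∀ n y, |v n y| ≤ b n * Real.exp (-2 * y)) :
    HasSum (fun n => ∫ y, v n y ∂halfLine) (∫ y, ∑' n, v n y ∂halfLine) := by
  have hi : ∀ n, Integrable (v n) halfLine := fun n =>
    (integrable_exp_neg_two.const_mul (b n)).mono' (hm n) (Eventually.of_forall (hv n))
  refine hasSum_integral_of_summable_integral_norm hi ?_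
  refine Summable.of_nonneg_of_le (fun n => integral_nonneg fun _ => norm_nonneg _) (fun n => ?_)
    (hb.mul_right (1 / 2))
  rw [← integral_exp_neg_two, ← integral_const_mul]
  exact integral_mono (hi n).norm (integrable_exp_neg_two.const_mul _) (hv n)

lemma DecayKernel.altSum_integral_mul_columnMinor (hK : DecayKernel K C) (hg : DecayFun g C)
    (hf : DecayFun f C') (k : ℕ) :
    altSum k (fun n => ∫ y, f y * columnMinor K g n y ∂halfLine) =
      ∫ y, f y * columnSeries K g k y ∂halfLine := by
  have hC := hK.nonneg
  have h := hasSum_integral_of_decay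
    (v := fun m y => f y * altTerm k (fun n => columnMinor K g n y) m)
    (((summable_altMajorant k hC).mul_left C).mul_left C')
    (fun m => hf.continuous.aestronglyMeasurable.mul
      ((hK.measurable_columnMinor hg).const_mul _).aestronglyMeasurable) (fun m y => by
      rw [abs_mul]
      calc _ ≤ (C' * Real.exp (-y)) * (C * altMajorant k C m * Real.exp (-y)) :=
            mul_le_mul (hf.bound y) (hK.abs_altTerm_columnMinor_le hg k m y) (abs_nonneg _)
              ((abs_nonneg _).trans (hf.bound _))
        _ = C' * (C * altMajorant k C m) * (Real.exp (-y) * Real.exp (-y)) := by ring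
        _ = _ := by rw [← Real.exp_add]; ring_nf)
  simp only [tsum_mul_left] at h
  refine Eq.trans ?_ h.tsum_eq
  refine tsum_congr fun m => ?_
  simp only [altTerm]
  rw [← integral_const_mul]
  congr 1; ext y; ring

lemma DecayKernel.growth_integral_mul_columnMinor (hK : DecayKernel K C) (hg : DecayFun g C)
    (hf : DecayFun f C') :
    HadamardGrowth (C' * C) C fun n => ∫ y, f y * columnMinor K g n y ∂halfLine := fun n => by
  have hC := hK.nonneg
  have hw := hadamardWeight_nonneg n
  have hC' : 0 ≤ C' := by simpa using (abs_nonneg _).trans (hf.bound 0)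
  rw [← Real.norm_eq_abs]
  refine (norm_integral_le_of_norm_le (integrable_exp_neg_two.const_mul
    (C' * C * (hadamardWeight n * C ^ n))) (Eventually.of_forall fun y => ?_)).trans ?_
  · rw [norm_mul, Real.norm_eq_abs, Real.norm_eq_abs]
    calc _ ≤ (C' * Real.exp (-y)) * (C * Real.exp (-y) * (hadamardWeight n * C ^ n)) :=
          mul_le_mul (hf.bound y) (hK.growth_columnMinor hg y n) (abs_nonneg _)
            ((abs_nonneg _).trans (hf.bound _))
      _ = C' * C * (hadamardWeight n * C ^ n) * (Real.exp (-y) * Real.exp (-y)) := by ring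
      _ = _ := by rw [← Real.exp_add]; ring_nf
  · rw [integral_const_mul, integral_exp_neg_two]
    exact mul_le_of_le_one_right (by positivity) (by norm_num)

lemma DecayKernel.columnSeries_zero (hK : DecayKernel K C) (hg : DecayFun g C) (y : ℝ) :
    columnSeries K g 0 y = g y * altSum 0 (kernelMinor K) +
      ∫ l, K y l * columnSeries K g 0 l ∂halfLine := by
  rw [← hK.altSum_integral_mul_columnMinor hg (hK.decayFun y)]
  exact altSum_zero_eq hK.nonneg hK.growth_kernelMinor (hK.growth_columnMinor hg y)
    (hK.growth_integral_mul_columnMinor hg (hK.decayFun y)) (columnMinor_zero y)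
    fun n => hK.columnMinor_succ hg y

lemma DecayKernel.columnSeries_succ (hK : DecayKernel K C) (hg : DecayFun g C) (k : ℕ) (y : ℝ) :
    columnSeries K g (k + 1) y = g y * altSum (k + 1) (kernelMinor K) +
      ∫ l, K y l * columnSeries K g (k + 1) l ∂halfLine +
      (k + 1) * ∫ l, K y l * columnSeries K g k l ∂halfLine := by
  rw [← hK.altSum_integral_mul_columnMinor hg (hK.decayFun y),
    ← hK.altSum_integral_mul_columnMinor hg (hK.decayFun y)]
  exact altSum_succ_eq hK.nonneg hK.growth_kernelMinor (hK.growth_columnMinor hg y)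
    (hK.growth_integral_mul_columnMinor hg (hK.decayFun y)) (fun n => hK.columnMinor_succ hg y) k

end Minors

section Diagonal

variable {K : ℝ → ℝ → ℝ} {C : ℝ} {n : ℕ}

lemma columnMinor_self (y : ℝ) : columnMinor K (fun z => K z y) n y =
    ∫ x, (kernelMatrix K (Fin.cons y x : Fin (n + 1) → ℝ)).det ∂halfSpace n := by
  simp only [columnMinor, replacedMatrix_self]

lemma DecayKernel.growth_columnMinor_self (hK : DecayKernel K C) (y : ℝ) :
    HadamardGrowth (C * Real.exp (-2 * y)) C fun n => columnMinor K (fun z => K z y) n y := by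
  intro n
  have hC := hK.nonneg
  have hw := hadamardWeight_nonneg n
  simp only [columnMinor_self]
  rw [← Real.norm_eq_abs]
  refine (norm_integral_le_of_norm_le ((integrable_expWeight n).const_mul
    (hadamardWeight n * C ^ (n + 1) * Real.exp (-2 * y)))
    (Eventually.of_forall fun x => (hK.abs_det_le _).trans_eq ?_)).trans ?_
  · rw [expWeight_cons, hadamardWeight]; ring
  · rw [integral_const_mul]
    refine (mul_le_of_le_one_right (by positivity) (integral_expWeight_le n)).trans_eq ?_
    ring

lemma DecayKernel.measurable_columnMinor_self (hK : DecayKernel K C) :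
    StronglyMeasurable fun y => columnMinor K (fun z => K z y) n y := by
  simp only [columnMinor_self]
  have h : Continuous fun p : ℝ × (Fin n → ℝ) =>
      (kernelMatrix K (Fin.cons p.1 p.2 : Fin (n + 1) → ℝ)).det :=
    hK.continuous_det.comp (Continuous.finCons continuous_fst continuous_snd)
  exact h.stronglyMeasurable.integral_prod_right'

lemma DecayKernel.altSum_succ_kernelMinor (hK : DecayKernel K C) (k : ℕ) :
    altSum (k + 1) (kernelMinor K) =
      -∫ y, columnSeries K (fun z => K z y) k y ∂halfLine := by
  have hC := hK.nonneg
  have h := hasSum_integral_of_decay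
    (v := fun m y => altTerm k (fun n => columnMinor K (fun z => K z y) n y) m)
    ((summable_altMajorant k hC).mul_left C)
    (fun m => (hK.measurable_columnMinor_self.const_mul _).aestronglyMeasurable) (fun m y =>
      (abs_altTerm_le (hK.growth_columnMinor_self y) k m).trans_eq (by ring))
  refine Eq.trans ?_ h.neg.tsum_eq
  refine tsum_congr fun m => ?_
  simp only [altTerm]
  rw [integral_const_mul, ← add_assoc, hK.kernelMinor_succ]
  ring

end Diagonal

lemma exists_decayKernel_KAi (ξ : ℝ) : ∃ C, DecayKernel (KAi ξ) C := by
  obtain ⟨C, hC, h⟩ := abs_KAi_le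
  exact ⟨C * Real.exp (-2 * ξ), continuous_KAi ξ, by positivity, h ξ⟩

lemma exists_decay_KAi_left (ξ y : ℝ) :
    ∃ C, DecayKernel (KAi ξ) C ∧ DecayFun (fun z => KAi ξ z y) C := by
  obtain ⟨C, hC⟩ := exists_decayKernel_KAi ξ
  refine ⟨max C (C * Real.exp (-y)), hC.mono (le_max_left _ _), ?_⟩
  refine ⟨hC.continuous_comp continuous_id continuous_const, fun x => ?_⟩
  calc _ ≤ _ := hC.bound x y
    _ = C * Real.exp (-y) * Real.exp (-x) := by ring
    _ ≤ _ := by gcongr; exact le_max_right _ _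

/-- The Fredholm determinant does not vanish when a resolvent kernel exists. -/
lemma altSum_kernelMinor_ne_zero {ξ : ℝ} {R : ℝ → ℝ → ℝ} (hne : ∃ x, Ai x ≠ 0)
    (hR : ∀ v w, R v w = KAi ξ v w + ∫ l, KAi ξ v l * R l w ∂halfLine) :
    altSum 0 (kernelMinor (KAi ξ)) ≠ 0 := by
  intro h0
  obtain ⟨C, hC⟩ := exists_decayKernel_KAi ξ
  have key : ∀ k, altSum k (kernelMinor (KAi ξ)) = 0 ∧
      ∀ z y, columnSeries (KAi ξ) (fun x => KAi ξ x z) k y = 0 := by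
    intro k
    induction k with
    | zero =>
      refine ⟨h0, fun z y => ?_⟩
      obtain ⟨C', hK, hg⟩ := exists_decay_KAi_left ξ z
      refine eq_zero_of_eq_integral_KAi_mul hne hR (hK.expDecay_columnSeries hg 0) (fun x => ?_) y
      rw [hK.columnSeries_zero hg x, h0, mul_zero, zero_add]
    | succ k ih =>
      have h1 : altSum (k + 1) (kernelMinor (KAi ξ)) = 0 := by
        simp [hC.altSum_succ_kernelMinor, ih.2]
      refine ⟨h1, fun z y => ?_⟩
      obtain ⟨C', hK, hg⟩ := exists_decay_KAi_left ξ z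
      refine eq_zero_of_eq_integral_KAi_mul hne hR (hK.expDecay_columnSeries hg (k + 1))
        (fun x => ?_) y
      rw [hK.columnSeries_succ hg k x, h1]
      simp [ih.2]
  have := eq_zero_of_altSum_eq_zero hC.nonneg hC.growth_kernelMinor fun k => (key k).1
  simp [kernelMinor_zero] at this

lemma restrict_positive_eq_halfSpace (n : ℕ) :
    (volume : Measure (Fin n → ℝ)).restrict {x | ∀ i, 0 < x i} = halfSpace n := by
  have : {x : Fin n → ℝ | ∀ i, 0 < x i} = Set.univ.pi fun _ => Set.Ioi 0 := by
    ext x; simp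
  rw [this, volume_pi, Measure.restrict_pi_pi]

lemma F₂_eq_altSum (ξ : ℝ) : F₂ ξ = altSum 0 (kernelMinor (KAi ξ)) := by
  refine tsum_congr fun n => ?_
  rw [restrict_positive_eq_halfSpace, altTerm, kernelMinor, add_zero, div_mul_eq_mul_div, one_mul,
    div_mul_eq_mul_div, ← integral_const_mul]
  congr 2
  ext x
  have : (Matrix.of fun i j => -KAi ξ (x i) (x j)) = -kernelMatrix (KAi ξ) x := rfl
  rw [this, Matrix.det_neg, Fintype.card_fin]

/-- Jacobi's formula, column by column. -/
lemma hasDerivAt_det {n : ℕ} {M : ℝ → Matrix (Fin n) (Fin n) ℝ} {M' : Matrix (Fin n) (Fin n) ℝ}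
    {t : ℝ} (h : ∀ i j, HasDerivAt (fun s => M s i j) (M' i j) t) :
    HasDerivAt (fun s => (M s).det) (∑ j, ((M t).updateCol j fun i => M' i j).det) t := by
  simp only [Matrix.det_apply']
  rw [Finset.sum_comm]
  refine HasDerivAt.fun_sum fun σ _ => ?_
  rw [← Finset.mul_sum]
  refine HasDerivAt.const_mul _ ?_
  refine (HasDerivAt.fun_finsetProd (u := Finset.univ) fun i _ => h (σ i) i).congr_deriv ?_
  refine Finset.sum_congr rfl fun j _ => ?_
  rw [← Finset.mul_prod_erase _ _ (Finset.mem_univ j), smul_eq_mul, mul_comm]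
  simp only [Matrix.updateCol_self]
  congr 1
  refine Finset.prod_congr rfl fun k hk => ?_
  rw [Matrix.updateCol_ne (Finset.ne_of_mem_erase hk)]

lemma hasDerivAt_det_kernelMatrix_KAi {n : ℕ} (ξ : ℝ) (x : Fin n → ℝ) :
    HasDerivAt (fun ξ => (kernelMatrix (KAi ξ) x).det)
      (-∑ j, Ai (ξ + x j) * (replacedMatrix (KAi ξ) (fun z => Ai (ξ + z)) j x).det) ξ := by
  refine (hasDerivAt_det (M := fun ξ => kernelMatrix (KAi ξ) x)
    (M' := Matrix.of fun i j => -(Ai (ξ + x i) * Ai (ξ + x j)))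
    fun i j => hasDerivAt_KAi ξ (x i) (x j)).congr_deriv ?_
  rw [← Finset.sum_neg_distrib]
  refine Finset.sum_congr rfl fun j _ => ?_
  rw [← neg_mul]
  refine Eq.trans ?_ (Matrix.det_updateCol_smul (kernelMatrix (KAi ξ) x) j (-Ai (ξ + x j))
    fun i => Ai (ξ + x i))
  congr 2
  ext i
  simp [mul_comm]

lemma exists_uniform_decay_KAi (ξ₀ : ℝ) : ∃ C, ∀ ξ ∈ Metric.ball ξ₀ 1,
    DecayKernel (KAi ξ) C ∧ DecayFun (fun z => Ai (ξ + z)) C := by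
  obtain ⟨C₁, hC₁, h₁⟩ := abs_KAi_le
  obtain ⟨C₂, hC₂, h₂⟩ := abs_Ai_le
  refine ⟨max (C₁ * Real.exp (-2 * (ξ₀ - 1))) (C₂ * Real.exp (-(ξ₀ - 1))), fun ξ hξ => ⟨?_, ?_⟩⟩
  · rw [Metric.mem_ball, Real.dist_eq, abs_lt] at hξ
    refine DecayKernel.mono ⟨continuous_KAi ξ, by positivity, fun x y => (h₁ ξ x y).trans ?_⟩
      (le_max_left _ _)
    refine mul_le_mul_of_nonneg_right (mul_le_mul_of_nonneg_left ?_ hC₁) (by positivity)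
    exact Real.exp_le_exp.2 (by linarith)
  · rw [Metric.mem_ball, Real.dist_eq, abs_lt] at hξ
    refine DecayFun.mono ⟨continuous_Ai.comp (by fun_prop), fun x => (h₂ _).trans ?_⟩
      (le_max_right _ _)
    rw [neg_add, Real.exp_add, ← mul_assoc]
    gcongr
    linarith

lemma hasDerivAt_kernelMinor_succ_KAi (n : ℕ) (ξ₀ : ℝ) :
    HasDerivAt (fun ξ => kernelMinor (KAi ξ) (n + 1))
      (-((n + 1) * ∫ y, Ai (ξ₀ + y) * columnMinor (KAi ξ₀) (fun z => Ai (ξ₀ + z)) n y ∂halfLine))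
      ξ₀ := by
  obtain ⟨C, hC⟩ := exists_uniform_decay_KAi ξ₀
  obtain ⟨hK, hg⟩ := hC ξ₀ (Metric.mem_ball_self one_pos)
  have hInt : ∀ j : Fin (n + 1), Integrable (fun x : Fin (n + 1) → ℝ => Ai (ξ₀ + x j) *
      (replacedMatrix (KAi ξ₀) (fun z => Ai (ξ₀ + z)) j x).det) (halfSpace (n + 1)) := fun j =>
    hK.integrable_mul_det_replaced hg hg j
  refine (hasDerivAt_integral_of_dominated_loc_of_deriv_le
    (F := fun ξ x => (kernelMatrix (KAi ξ) x).det)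
    (F' := fun ξ x =>
      -∑ j, Ai (ξ + x j) * (replacedMatrix (KAi ξ) (fun z => Ai (ξ + z)) j x).det)
    (bound := fun x => ∑ _j : Fin (n + 1),
      C * (√(n + 1 : ℕ) ^ (n + 1) * C ^ (n + 1)) * expWeight x)
    (Metric.ball_mem_nhds ξ₀ one_pos) ?_ hK.integrable_det ?_ ?_ ?_ ?_).2.congr_deriv ?_
  · filter_upwards [Metric.ball_mem_nhds ξ₀ one_pos] with ξ hξ
    exact (hC ξ hξ).1.continuous_det.aestronglyMeasurable
  · exact (integrable_finsetSum _ fun j _ => hInt j).neg.aestronglyMeasurable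
  · refine Eventually.of_forall fun x ξ hξ => ?_
    rw [norm_neg]
    refine norm_sum_le_of_le _ fun j _ => ?_
    exact (hC ξ hξ).1.abs_mul_det_replaced_le (hC ξ hξ).2 (hC ξ hξ).2 j x
  · exact integrable_finsetSum _ fun j _ => (integrable_expWeight _).const_mul _
  · exact Eventually.of_forall fun x ξ _ => hasDerivAt_det_kernelMatrix_KAi ξ x
  · rw [integral_neg, integral_finsetSum _ fun j _ => hInt j]
    have h := fun j : Fin (n + 1) => hK.integral_mul_det_replaced hg hg j
    simp only [h]
    simp

lemma hasDerivAt_F₂ (ξ₀ : ℝ) :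
    HasDerivAt F₂
      (∫ y, Ai (ξ₀ + y) * columnSeries (KAi ξ₀) (fun z => Ai (ξ₀ + z)) 0 y ∂halfLine) ξ₀ := by
  obtain ⟨C, hC⟩ := exists_uniform_decay_KAi ξ₀
  have h₀ := Metric.mem_ball_self (x := ξ₀) one_pos
  obtain ⟨hK, hg⟩ := hC ξ₀ h₀
  rw [← hK.altSum_integral_mul_columnMinor hg hg 0]
  have hF : ∀ ξ ∈ Metric.ball ξ₀ 1,
      F₂ ξ = 1 + ∑' n, altTerm 0 (kernelMinor (KAi ξ)) (n + 1) := by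
    intro ξ hξ
    rw [F₂_eq_altSum, altSum,
      (summable_altTerm (hC ξ hξ).1.nonneg (hC ξ hξ).1.growth_kernelMinor 0).tsum_eq_zero_add]
    simp [altTerm, kernelMinor_zero]
  refine HasDerivAt.congr_of_eventuallyEq (HasDerivAt.const_add 1 ?_)
    (Filter.eventuallyEq_of_mem (Metric.ball_mem_nhds ξ₀ one_pos) hF)
  refine hasDerivAt_tsum_of_isPreconnected
    (g := fun n ξ => altTerm 0 (kernelMinor (KAi ξ)) (n + 1))
    (g' := fun n ξ => altTerm 0 (fun n => ∫ y, Ai (ξ + y) *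
      columnMinor (KAi ξ) (fun z => Ai (ξ + z)) n y ∂halfLine) n)
    ((summable_altMajorant 0 hK.nonneg).mul_left (C * C)) Metric.isOpen_ball
    (convex_ball ξ₀ 1).isPreconnected (fun n ξ _ => ?_) (fun n ξ hξ => ?_) h₀ ?_ h₀
  · refine ((hasDerivAt_kernelMinor_succ_KAi n ξ).const_mul
      ((-1) ^ (n + 1) / ((n + 1).factorial : ℝ))).congr_deriv ?_
    simp only [altTerm, add_zero, Nat.factorial_succ]
    push_cast
    field_simp
    ring
  · exact abs_altTerm_le ((hC ξ hξ).1.growth_integral_mul_columnMinor (hC ξ hξ).2 (hC ξ hξ).2) 0 n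
  · exact (summable_nat_add_iff 1).2 (summable_altTerm hK.nonneg hK.growth_kernelMinor 0)

lemma Ami_mul_Apl (ξ η v w : ℝ) : Ami ξ η v * Apl ξ η w =
    Real.exp (-η * (v - w)) * (Ai (ξ + η ^ 2 + v) * Ai (ξ + η ^ 2 + w)) := by
  have h : Real.exp (-η * (v - w)) = Real.exp (-((ξ + v) * η) - 2 * η ^ 3 / 3) *
      Real.exp ((ξ + w) * η + 2 * η ^ 3 / 3) := by
    rw [← Real.exp_add]; ring_nf
  rw [h, Ami, Apl]
  ring

lemma Kstar_eq_exp_mul_KAi (ξ η v w : ℝ) :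
    Kstar ξ η v w = Real.exp (-η * (v - w)) * KAi (ξ + η ^ 2) v w := by
  rw [Kstar, KAi, ← integral_const_mul]
  refine integral_congr_ae (Eventually.of_forall fun l => ?_)
  dsimp only
  rw [Ami_mul_Apl]
  ring_nf

/-- Conjugating a resolvent kernel of `Kstar` gives one of the shifted Airy kernel. -/
lemma resolvent_KAi_of_resolvent_Kstar {ξ η : ℝ} {R : ℝ → ℝ → ℝ}
    (hR : ∀ v w, R v w = Kstar ξ η v w + kComp (Kstar ξ η) R v w) (v w : ℝ) :
    Real.exp (η * (v - w)) * R v w = KAi (ξ + η ^ 2) v w +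
      ∫ l, KAi (ξ + η ^ 2) v l * (Real.exp (η * (l - w)) * R l w) ∂halfLine := by
  rw [hR v w, kComp, mul_add, ← integral_const_mul, Kstar_eq_exp_mul_KAi, ← mul_assoc,
    ← Real.exp_add]
  congr 1
  · ring_nf; simp
  · refine integral_congr_ae (Eventually.of_forall fun l => ?_)
    dsimp only
    rw [Kstar_eq_exp_mul_KAi,
      show η * (l - w) = η * (v - w) + -η * (v - l) by ring, Real.exp_add]
    ring

/-- The logarithmic derivative of the Airy Fredholm determinant through its resolvent. -/
lemma integral_add_integral_resolvent_KAi {ξ : ℝ} {R : ℝ → ℝ → ℝ} (hne : ∃ x, Ai x ≠ 0)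
    (hR : ∀ v w, R v w = KAi ξ v w + ∫ l, KAi ξ v l * R l w ∂halfLine) :
    (∫ y, Ai (ξ + y) * Ai (ξ + y) ∂halfLine) +
      ∫ y, Ai (ξ + y) * ∫ z, R y z * Ai (ξ + z) ∂halfLine ∂halfLine = deriv F₂ ξ / F₂ ξ := by
  have hD : F₂ ξ ≠ 0 := by
    rw [F₂_eq_altSum]
    exact altSum_kernelMinor_ne_zero hne hR
  obtain ⟨C, hC⟩ := exists_uniform_decay_KAi ξ
  obtain ⟨hK, hg⟩ := hC ξ (Metric.mem_ball_self one_pos)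
  have hu := hK.expDecay_columnSeries hg 0
  have ha := expDecay_Ai ξ
  have key : ∀ y, columnSeries (KAi ξ) (fun z => Ai (ξ + z)) 0 y =
      F₂ ξ * (Ai (ξ + y) + ∫ z, R y z * Ai (ξ + z) ∂halfLine) :=
    eq_of_eq_const_mul_add_integral_KAi_mul hne hR ha hu fun x => by
      rw [hK.columnSeries_zero hg x, F₂_eq_altSum, mul_comm (Ai _)]
  have hv : ExpDecay fun y => ∫ z, R y z * Ai (ξ + z) ∂halfLine := by
    convert! (hu.const_mul (F₂ ξ)⁻¹).add (ha.const_mul (-1)) using 2 with y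
    rw [key]
    field_simp
    ring
  rw [(hasDerivAt_F₂ ξ).deriv, eq_div_iff hD, ← integral_add (ha.integrable_mul ha)
    (ha.integrable_mul hv), mul_comm, ← integral_const_mul]
  refine integral_congr_ae (Eventually.of_forall fun y => ?_)
  dsimp only
  rw [key]
  ring

lemma deriv_F₂_eq_zero_of_Ai_eq_zero (h : ∀ x, Ai x = 0) (ξ : ℝ) : deriv F₂ ξ = 0 := by
  rw [(hasDerivAt_F₂ ξ).deriv]
  simp [h]

/-- `a₀(ξ₂,η₂) = tr (I−K₂*)⁻¹ A₋⊗A₊ = F₂'(ξ₂+η₂²)/F₂(ξ₂+η₂²)`, where the trace is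
expressed via the resolvent kernel `R = (I−K₂*)⁻¹K₂*`, so `(I−K₂*)⁻¹ = I + R`. -/
theorem a0_eq_tracy_widom_logderiv (ξ₂ η₂ : ℝ) (R : ℝ → ℝ → ℝ)
    (hR : ∀ v₁ v₂ : ℝ, R v₁ v₂ = Kstar ξ₂ η₂ v₁ v₂ + kComp (Kstar ξ₂ η₂) R v₁ v₂) :
    (∫ v in Set.Ioi (0 : ℝ), Ami ξ₂ η₂ v * Apl ξ₂ η₂ v) +
      (∫ v₁ in Set.Ioi (0 : ℝ), ∫ v₂ in Set.Ioi (0 : ℝ),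
        R v₁ v₂ * Ami ξ₂ η₂ v₂ * Apl ξ₂ η₂ v₁) =
      deriv F₂ (ξ₂ + η₂ ^ 2) / F₂ (ξ₂ + η₂ ^ 2) := by
  by_cases hne : ∃ x, Ai x ≠ 0
  · rw [← integral_add_integral_resolvent_KAi hne (resolvent_KAi_of_resolvent_Kstar hR)]
    congr 1
    · simp [Ami_mul_Apl]
    · refine integral_congr_ae (Eventually.of_forall fun v => ?_)
      dsimp only
      rw [← integral_const_mul]
      refine integral_congr_ae (Eventually.of_forall fun w => ?_)
      dsimp only
      rw [mul_assoc, Ami_mul_Apl, show -η₂ * (w - v) = η₂ * (v - w) by ring]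
      ring
  · push Not at hne
    simp [deriv_F₂_eq_zero_of_Ai_eq_zero hne, Ami, hne]
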